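/- Let F ∈ ℤ[x,y] have total degree 4 with F(0,0) = 0, and suppose F is not linked. Then for every positive integer C and every integer D, the value set F(ℤ²) is not equal to (Cℤ)_{≥D} = {Cn : n ∈ ℤ, Cn ≥ D}. -/

import Mathlib

open MvPolynomial

/-- Evaluation of an integer polynomial in two variables at a real point. -/
noncomputable def evalReal (G : MvPolynomial (Fin 2) ℤ) (x y : ℝ) : ℝ :=
  MvPolynomial.aeval ![x, y] G

/-- An integral binary form (or polynomial) is positive semi-definite if it is
nonnegative at every real point. -/
def PosSemidef2 (G : MvPolynomial (Fin 2) ℤ) : Prop :=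
  ∀ x y : ℝ, 0 ≤ evalReal G x y

/-- Positive definite: positive at every nonzero real point. -/
def PosDef2 (G : MvPolynomial (Fin 2) ℤ) : Prop :=
  ∀ x y : ℝ, (x, y) ≠ (0, 0) → 0 < evalReal G x y

/-- A primitive integral polynomial: the gcd of its coefficients is a unit. -/
def IsPrimitiveInt (G : MvPolynomial (Fin 2) ℤ) : Prop :=
  ∀ d : ℤ, (∀ m, d ∣ MvPolynomial.coeff m G) → IsUnit d

/-- The image of an integral polynomial in `ℚ[x,y]`. -/
noncomputable def toQ (G : MvPolynomial (Fin 2) ℤ) : MvPolynomial (Fin 2) ℚ :=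
  MvPolynomial.map (Int.castRingHom ℚ) G

/-- `Ft4` is the polynomial `F̃₄ = F₄ / P₀`, where `P₀` is the positive definite integral
form of largest degree (possibly a positive constant) dividing `F₄` such that the quotient
is a primitive integral form. -/
def IsTildePart (F4 Ft4 : MvPolynomial (Fin 2) ℤ) : Prop :=
  ∃ (P0 : MvPolynomial (Fin 2) ℤ) (k : ℕ),
    P0.IsHomogeneous k ∧ PosDef2 P0 ∧ F4 = P0 * Ft4 ∧
    (∃ n, Ft4.IsHomogeneous n) ∧ IsPrimitiveInt Ft4 ∧
    (∀ (P0' Ft4' : MvPolynomial (Fin 2) ℤ) (k' : ℕ),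
      P0'.IsHomogeneous k' → PosDef2 P0' → F4 = P0' * Ft4' →
      (∃ n, Ft4'.IsHomogeneous n) → IsPrimitiveInt Ft4' → k' ≤ k)

/-- Two integral polynomials have a common non-constant factor over `ℚ`
(i.e. their gcd in `ℚ[x,y]` is not 1). -/
def CommonFactor2 (A B : MvPolynomial (Fin 2) ℤ) : Prop :=
  ∃ d : MvPolynomial (Fin 2) ℚ, 0 < d.totalDegree ∧ d ∣ toQ A ∧ d ∣ toQ B

/-- Three integral polynomials have a common non-constant factor over `ℚ`. -/
def CommonFactor3 (A B C : MvPolynomial (Fin 2) ℤ) : Prop :=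
  ∃ d : MvPolynomial (Fin 2) ℚ, 0 < d.totalDegree ∧ d ∣ toQ A ∧ d ∣ toQ B ∧ d ∣ toQ C

/-- Four integral polynomials have a common non-constant factor over `ℚ`. -/
def CommonFactor4 (A B C D : MvPolynomial (Fin 2) ℤ) : Prop :=
  ∃ d : MvPolynomial (Fin 2) ℚ, 0 < d.totalDegree ∧
    d ∣ toQ A ∧ d ∣ toQ B ∧ d ∣ toQ C ∧ d ∣ toQ D

/-- The value set `F(ℤ²)`. -/
def valueSet (F : MvPolynomial (Fin 2) ℤ) : Set ℤ :=
  {m : ℤ | ∃ x y : ℤ, MvPolynomial.eval ![x, y] F = m}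

/-- The set `(Cℤ)_{≥ D} = {Cn : n ∈ ℤ, Cn ≥ D}`. -/
def targetSet (C D : ℤ) : Set ℤ :=
  {m : ℤ | (∃ n : ℤ, m = C * n) ∧ D ≤ m}

/-- `F` is linked: `F₄` is positive semi-definite, `gcd(F̃₄, F₃) ≠ 1`
and `gcd(F̃₄, F₃, F₂) = 1`. -/
def Linked (F : MvPolynomial (Fin 2) ℤ) : Prop :=
  PosSemidef2 (MvPolynomial.homogeneousComponent 4 F) ∧
  ∃ Ft4 : MvPolynomial (Fin 2) ℤ,
    IsTildePart (MvPolynomial.homogeneousComponent 4 F) Ft4 ∧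
    CommonFactor2 Ft4 (MvPolynomial.homogeneousComponent 3 F) ∧
    ¬ CommonFactor3 Ft4 (MvPolynomial.homogeneousComponent 3 F)
        (MvPolynomial.homogeneousComponent 2 F)


theorem count_contra (F : ℤ → ℤ → ℤ) (C D : ℤ) (hC : 0 < C)
    (hs : ∀ n : ℤ, D ≤ C * n → ∃ x y, F x y = C * n) (K M0 : ℕ)
    (h : ∀ M : ℕ, M0 ≤ M → ∃ T : Finset ℤ, T.card ≤ K * M ^ 3 ∧
      ∀ x y, F x y ≤ (M : ℤ) ^ 4 → F x y ∈ T) : False := by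
  obtain ⟨M, hM⟩ : ∃ M : ℕ, M = M0 + 1 + C.natAbs * (D.natAbs + K) := ⟨_, rfl⟩
  obtain ⟨T, hT, hT'⟩ := h M (by omega)
  have hM1 : 1 ≤ M := by omega
  have hM2 : C * (|D| + K) ≤ M := by
    rw [hM]; push_cast; rw [abs_of_pos hC]; linarith
  have hsub : (Finset.Icc (|D|) (|D| + K * M ^ 3)).image (fun n => C * n) ⊆ T := by
    intro v hv
    simp only [Finset.mem_image, Finset.mem_Icc] at hv
    obtain ⟨n, ⟨h1, h2⟩, rfl⟩ := hv
    have hn : 0 ≤ n := le_trans (abs_nonneg _) h1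
    obtain ⟨x, y, hxy⟩ := hs n (by nlinarith [le_abs_self D])
    rw [← hxy]
    apply hT'
    rw [hxy]
    have hM1' : (1:ℤ) ≤ (M:ℤ) ^ 3 := by exact_mod_cast Nat.one_le_pow _ _ hM1
    calc C * n ≤ C * (|D| + K * M ^ 3) := by gcongr
      _ ≤ C * (|D| * M ^ 3 + K * M ^ 3) := by
          gcongr
          nlinarith [abs_nonneg D]
      _ = (C * (|D| + K)) * M ^ 3 := by ring
      _ ≤ M * (M:ℤ) ^ 3 := by gcongr
      _ = (M:ℤ) ^ 4 := by ring
  have hcard := Finset.card_le_card hsub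
  rw [Finset.card_image_of_injective _ (mul_right_injective₀ hC.ne')] at hcard
  simp only [Int.card_Icc] at hcard
  have : (|D| + (K:ℤ) * M ^ 3 + 1 - |D|) = ((K * M ^ 3 + 1 : ℕ) : ℤ) := by push_cast; ring
  rw [this, Int.toNat_natCast] at hcard
  omega

theorem quad_bdd (α β γ D : ℤ) (hb : ∀ x : ℤ, D ≤ α * x ^ 2 + β * x + γ) :
    0 ≤ α ∧ (α = 0 → β = 0) := by
  constructor
  · by_contra hα
    push Not at hα
    have h1 := hb (|β| + |γ| + |D| + 1)
    have e1 : β ≤ |β| := le_abs_self _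
    have e2 : γ ≤ |γ| := le_abs_self _
    have e3 : -|D| ≤ D := neg_abs_le _
    have := abs_nonneg β
    have := abs_nonneg γ
    have := abs_nonneg D
    set X := |β| + |γ| + |D| + 1
    have hX : 1 ≤ X := by omega
    have : α * X ^ 2 ≤ - X ^ 2 := by nlinarith [sq_nonneg X]
    have : β * X ≤ |β| * X := by gcongr
    have : X ^ 2 = |β| * X + |γ| * X + |D| * X + X := by simp only [X]; ring
    nlinarith
  · rintro rfl
    by_contra hβ
    have h1 := hb (-β * (|γ| + |D| + 1))
    have e2 : γ ≤ |γ| := le_abs_self _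
    have e3 : -|D| ≤ D := neg_abs_le _
    have := abs_nonneg γ
    have := abs_nonneg D
    have : 1 ≤ β ^ 2 := by
      have : 0 < β ^ 2 := by positivity
      omega
    nlinarith

theorem fiber_count (α β γ D N : ℤ) (H : ℕ) (hb : ∀ x : ℤ, D ≤ α * x ^ 2 + β * x + γ)
    (hα : α = 0 ∨ ∀ j : ℤ, 0 ≤ j → α * j ^ 2 ≤ N - D → j ≤ H) :
    ∃ T : Finset ℤ, T.card ≤ 4 * H + 3 ∧
      ∀ x, α * x ^ 2 + β * x + γ ≤ N → α * x ^ 2 + β * x + γ ∈ T := by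
  obtain ⟨h0, h1⟩ := quad_bdd α β γ D hb
  by_cases hz : α = 0
  · have := h1 hz
    subst hz; subst this
    exact ⟨{γ}, by simp, by simp⟩
  · have hα := hα.resolve_left hz
    by_cases hne : ∃ x0, α * x0 ^ 2 + β * x0 + γ ≤ N
    · obtain ⟨x0, hx0⟩ := hne
      have key : ∀ x h : ℤ, 0 ≤ h → α * x ^ 2 + β * x + γ ≤ N →
          α * (x + h) ^ 2 + β * (x + h) + γ ≤ N → h ≤ 2 * H + 1 := by
        intro x h hh hx hxh
        rcases Int.even_or_odd' h with ⟨j, rfl | rfl⟩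
        · have := hα j (by omega) (by nlinarith [hb (x + j)])
          omega
        · have hj : 0 ≤ j := by omega
          have := hα j (by omega) (by nlinarith [hb (x + j), hb (x + j + 1), mul_nonneg h0 hj])
          omega
      refine ⟨(Finset.Icc (x0 - (2 * H + 1)) (x0 + (2 * H + 1))).image
        (fun x => α * x ^ 2 + β * x + γ), ?_, ?_⟩
      · refine Finset.card_image_le.trans ?_
        simp only [Int.card_Icc]
        omega
      · intro x hx
        refine Finset.mem_image.2 ⟨x, ?_, rfl⟩
        rw [Finset.mem_Icc]
        rcases le_total x x0 with hle | hle
        · have := key x (x0 - x) (by omega) hx (by simpa using hx0)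
          omega
        · have := key x0 (x - x0) (by omega) hx0 (by simpa using hx)
          omega
    · push Not at hne
      exact ⟨∅, by simp, fun x hx => absurd hx (by have := hne x; omega)⟩

theorem family_count (α β γ : ℤ → ℤ) (Y B : ℕ)
    (P : ℤ → Prop) (N : ℤ)
    (hT : ∀ y, P y → ∃ T : Finset ℤ, T.card ≤ B ∧
      ∀ x, α y * x ^ 2 + β y * x + γ y ≤ N → α y * x ^ 2 + β y * x + γ y ∈ T) :
    ∃ T : Finset ℤ, T.card ≤ (2 * Y + 1) * B ∧
      ∀ x y, P y → |y| ≤ Y → α y * x ^ 2 + β y * x + γ y ≤ N →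
        α y * x ^ 2 + β y * x + γ y ∈ T := by
  classical
  choose! T h1 h2 using hT
  refine ⟨(Finset.Icc (-(Y:ℤ)) Y).biUnion (fun y => if P y then T y else ∅), ?_, ?_⟩
  · refine (Finset.card_biUnion_le_card_mul _ _ B ?_).trans ?_
    · intro y _
      split_ifs with hP
      · exact h1 y hP
      · simp
    · apply Nat.mul_le_mul_right
      simp only [Int.card_Icc]
      omega
  · intro x y hP hy hN
    rw [Finset.mem_biUnion]
    refine ⟨y, ?_, ?_⟩
    · rw [Finset.mem_Icc]; exact abs_le.1 hy
    · rw [if_pos hP]; exact h2 y hP x hN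

/-- Case I: `|y| = O(M)`. -/
theorem caseI (α β γ : ℤ → ℤ) (C D : ℤ) (hC : 0 < C)
    (hb : ∀ x y : ℤ, D ≤ α y * x ^ 2 + β y * x + γ y)
    (hs : ∀ n : ℤ, D ≤ C * n → ∃ x y, α y * x ^ 2 + β y * x + γ y = C * n)
    (K M0 : ℕ)
    (hK : ∀ M : ℕ, M0 ≤ M → ∀ x y, α y * x ^ 2 + β y * x + γ y ≤ (M:ℤ) ^ 4 → |y| ≤ K * M) :
    False := by
  refine count_contra (fun x y => α y * x ^ 2 + β y * x + γ y) C D hC hs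
    ((2 * K + 1) * 11) (M0 + D.natAbs + 1) ?_
  intro M hM
  have hM1 : 1 ≤ M := by omega
  have hDM : -D ≤ M := by omega
  have hM4 : (M:ℤ) ≤ (M:ℤ) ^ 4 := by
    exact_mod_cast Nat.le_self_pow (by norm_num) M
  obtain ⟨T, hT1, hT2⟩ := family_count α β γ (K * M) (4 * (2 * M ^ 2) + 3) (fun _ => True)
    ((M:ℤ) ^ 4) (by
      intro y _
      apply fiber_count _ _ _ D _ _ (fun x => hb x y)
      obtain ⟨h0, -⟩ := quad_bdd _ _ _ D (fun x => hb x y)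
      rcases h0.eq_or_lt with h | h
      · exact Or.inl h.symm
      · right
        intro j hj hj2
        push_cast
        by_contra hc
        push Not at hc
        have : (2 * (M:ℤ) ^ 2) ^ 2 < j ^ 2 := by gcongr
        nlinarith [sq_nonneg j])
  refine ⟨T, hT1.trans ?_, fun x y hxy => hT2 x y trivial ?_ hxy⟩
  · calc (2 * (K * M) + 1) * (4 * (2 * M ^ 2) + 3)
        ≤ (2 * (K * M) + M) * (4 * (2 * M ^ 2) + 3 * M ^ 2) := by
          gcongr
          have := Nat.one_le_pow 2 M hM1
          omega
      _ = (2 * K + 1) * 11 * M ^ 3 := by ring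
  · have := hK M (by omega) x y hxy
    push_cast
    exact this

/-- Case II: `|y| = O(M^2)` and leading coefficient of size `y^2`. -/
theorem caseII (α β γ : ℤ → ℤ) (C D : ℤ) (hC : 0 < C)
    (hb : ∀ x y : ℤ, D ≤ α y * x ^ 2 + β y * x + γ y)
    (hs : ∀ n : ℤ, D ≤ C * n → ∃ x y, α y * x ^ 2 + β y * x + γ y = C * n)
    (K M0 : ℕ)
    (hα : ∀ y : ℤ, (M0:ℤ) ≤ |y| → y ^ 2 ≤ 2 * α y)
    (hK : ∀ M : ℕ, M0 ≤ M → ∀ x y, α y * x ^ 2 + β y * x + γ y ≤ (M:ℤ) ^ 4 →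
      α y * x ^ 2 + β y * x + γ y = 0 ∨ |y| ≤ K * M ^ 2) :
    False := by
  refine count_contra (fun x y => α y * x ^ 2 + β y * x + γ y) C D hC hs
    (33 + (2 * K + 1) * 11 + 1) (M0 + D.natAbs + 1) ?_
  intro M hM
  have hM1 : 1 ≤ M := by omega
  have hDM : -D ≤ M := by omega
  have hM4 : (M:ℤ) ≤ (M:ℤ) ^ 4 := by
    exact_mod_cast Nat.le_self_pow (by norm_num) M
  obtain ⟨T, hT1, hT2⟩ := family_count α β γ M (4 * (2 * M ^ 2) + 3) (fun _ => True)
    ((M:ℤ) ^ 4) (by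
      intro y _
      apply fiber_count _ _ _ D _ _ (fun x => hb x y)
      obtain ⟨h0, -⟩ := quad_bdd _ _ _ D (fun x => hb x y)
      rcases h0.eq_or_lt with h | h
      · exact Or.inl h.symm
      · right
        intro j hj hj2
        push_cast
        by_contra hc
        push Not at hc
        have : (2 * (M:ℤ) ^ 2) ^ 2 < j ^ 2 := by gcongr
        nlinarith [sq_nonneg j])
  obtain ⟨T', hT1', hT2'⟩ := family_count α β γ (K * M ^ 2) (4 * (2 * M) + 3)
    (fun y => (M:ℤ) < |y|) ((M:ℤ) ^ 4) (by
      intro y hy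
      apply fiber_count _ _ _ D _ _ (fun x => hb x y)
      right
      intro j hj hj2
      push_cast
      have h1 := hα y (by omega)
      have h2 : (M:ℤ) ^ 2 < y ^ 2 := by
        rw [← sq_abs y]; gcongr
      by_contra hc
      push Not at hc
      have h3 : (2 * (M:ℤ)) ^ 2 < j ^ 2 := by gcongr
      have h4 : (M:ℤ) ^ 2 * (2 * (M:ℤ)) ^ 2 < y ^ 2 * j ^ 2 := by gcongr
      have h5 : y ^ 2 * j ^ 2 ≤ 2 * α y * j ^ 2 := by gcongr
      nlinarith)
  refine ⟨T ∪ T' ∪ {0}, ?_, fun x y hxy => ?_⟩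
  · have e0 := Nat.one_le_pow 2 M hM1
    have e1 : (2 * M + 1) * (4 * (2 * M ^ 2) + 3) ≤ 33 * M ^ 3 := by
      have : (2 * M + 1) * (4 * (2 * M ^ 2) + 3) ≤ (3 * M) * (11 * M ^ 2) :=
        Nat.mul_le_mul (by omega) (by omega)
      exact this.trans (le_of_eq (by ring))
    have e2 : (2 * (K * M ^ 2) + 1) * (4 * (2 * M) + 3) ≤ (2 * K + 1) * 11 * M ^ 3 := by
      have : (2 * (K * M ^ 2) + 1) * (4 * (2 * M) + 3) ≤ (2 * (K * M ^ 2) + M ^ 2) * (11 * M) :=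
        Nat.mul_le_mul (by omega) (by omega)
      exact this.trans (le_of_eq (by ring))
    have e3 := Nat.one_le_pow 3 M hM1
    calc (T ∪ T' ∪ {0}).card ≤ T.card + T'.card + 1 := by
          refine (Finset.card_union_le _ _).trans ?_
          have := Finset.card_union_le T T'
          simp only [Finset.card_singleton]
          omega
      _ ≤ 33 * M ^ 3 + (2 * K + 1) * 11 * M ^ 3 + M ^ 3 := by omega
      _ = _ := by ring
  · simp only [Finset.mem_union, Finset.mem_singleton]
    rcases hK M (by omega) x y hxy with h | h
    · right; exact h
    · left
      rcases le_or_gt |y| (M:ℤ) with h' | h'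
      · left; exact hT2 x y trivial h' hxy
      · right; exact hT2' x y h' (by push_cast; exact h) hxy

theorem poly_small (p3 p2 p1 p0 y : ℤ) (h1 : 1 ≤ |y|)
    (hy : 2 * (|p3| + |p2| + |p1| + |p0|) ≤ |y|) :
    -y ^ 4 ≤ 2 * (p3 * y ^ 3 + p2 * y ^ 2 + p1 * y + p0) := by
  have e : |p3 * y ^ 3 + p2 * y ^ 2 + p1 * y + p0| ≤ (|p3| + |p2| + |p1| + |p0|) * |y| ^ 3 := by
    have t3 : |p3 * y ^ 3| = |p3| * |y| ^ 3 := by rw [abs_mul, abs_pow]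
    have t2 : |p2 * y ^ 2| ≤ |p2| * |y| ^ 3 := by
      rw [abs_mul, abs_pow]; gcongr <;> norm_num
    have t1 : |p1 * y| ≤ |p1| * |y| ^ 3 := by
      rw [abs_mul]; gcongr; exact le_self_pow₀ h1 (by norm_num)
    have t0 : |p0| ≤ |p0| * |y| ^ 3 := by
      have : 1 ≤ |y| ^ 3 := one_le_pow₀ h1
      nlinarith [abs_nonneg p0]
    calc _ ≤ |p3 * y ^ 3| + |p2 * y ^ 2| + |p1 * y| + |p0| := by
          refine (abs_add_le _ _).trans ?_
          gcongr
          refine (abs_add_le _ _).trans ?_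
          gcongr
          exact abs_add_le _ _
      _ ≤ _ := by linarith
  have e2 : 2 * (|p3| + |p2| + |p1| + |p0|) * |y| ^ 3 ≤ |y| * |y| ^ 3 := by gcongr
  have e3 : |y| * |y| ^ 3 = y ^ 4 := by
    have : |y| ^ 4 = y ^ 4 := by rw [← abs_pow]; exact abs_of_nonneg (by positivity)
    rw [← this]; ring
  have := neg_abs_le (p3 * y ^ 3 + p2 * y ^ 2 + p1 * y + p0)
  linarith

theorem nf_zero (a4 b3 c2 e1 C D : ℤ) (hC : 0 < C) (ha : 0 < a4)
    (hb : ∀ x y : ℤ, D ≤ 0 * x ^ 2 + 0 * x + (a4 * y ^ 4 + b3 * y ^ 3 + c2 * y ^ 2 + e1 * y))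
    (hs : ∀ n : ℤ, D ≤ C * n → ∃ x y : ℤ,
      0 * x ^ 2 + 0 * x + (a4 * y ^ 4 + b3 * y ^ 3 + c2 * y ^ 2 + e1 * y) = C * n) : False := by
  refine caseI (fun _ => 0) (fun _ => 0) (fun y => a4 * y ^ 4 + b3 * y ^ 3 + c2 * y ^ 2 + e1 * y)
    C D hC hb hs 2 (2 * (b3.natAbs + c2.natAbs + e1.natAbs) + 1) ?_
  intro M hM x y h
  by_contra hc
  push Not at hc
  push_cast at hc
  have hMZ : 2 * (|b3| + |c2| + |e1|) + 1 ≤ (M:ℤ) := by zify at hM; exact hM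
  have := abs_nonneg b3
  have := abs_nonneg c2
  have := abs_nonneg e1
  have := poly_small b3 c2 e1 0 y (by omega) (by rw [abs_zero]; omega)
  have h4 : (2 * (M:ℤ)) ^ 4 < |y| ^ 4 := by gcongr
  have h4' : |y| ^ 4 = y ^ 4 := by rw [← abs_pow]; exact abs_of_nonneg (by positivity)
  have hM1 : (0:ℤ) ≤ (M:ℤ) ^ 4 := by positivity
  have h5 : y ^ 4 ≤ a4 * y ^ 4 := by nlinarith [show 0 ≤ y ^ 4 by positivity]
  nlinarith

theorem nf_pos (a2 a3 a4 b1 b2 b3 c1 c2 e1 C D : ℤ) (hC : 0 < C) (ha : 0 < a2)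
    (hδ : 0 < 4 * a2 * a4 - a3 ^ 2)
    (hb : ∀ x y : ℤ, D ≤ (a2 * y ^ 2 + b1 * y) * x ^ 2 + (a3 * y ^ 3 + b2 * y ^ 2 + c1 * y) * x
      + (a4 * y ^ 4 + b3 * y ^ 3 + c2 * y ^ 2 + e1 * y))
    (hs : ∀ n : ℤ, D ≤ C * n → ∃ x y : ℤ,
      (a2 * y ^ 2 + b1 * y) * x ^ 2 + (a3 * y ^ 3 + b2 * y ^ 2 + c1 * y) * x
      + (a4 * y ^ 4 + b3 * y ^ 3 + c2 * y ^ 2 + e1 * y) = C * n) : False := by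
  obtain ⟨p3, hp3⟩ : ∃ p3, p3 = 4 * (a2 * b3 + b1 * a4) - 2 * a3 * b2 := ⟨_, rfl⟩
  obtain ⟨p2, hp2⟩ : ∃ p2, p2 = 4 * (a2 * c2 + b1 * b3) - b2 ^ 2 - 2 * a3 * c1 := ⟨_, rfl⟩
  obtain ⟨p1, hp1⟩ : ∃ p1, p1 = 4 * (a2 * e1 + b1 * c2) - 2 * b2 * c1 := ⟨_, rfl⟩
  obtain ⟨p0, hp0⟩ : ∃ p0, p0 = 4 * (b1 * e1) - c1 ^ 2 := ⟨_, rfl⟩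
  refine caseI _ _ _ C D hC hb hs (8 * (a2.natAbs + b1.natAbs))
    (2 * (p3.natAbs + p2.natAbs + p1.natAbs + p0.natAbs) + 1) ?_
  intro M hM x y h
  by_contra hc
  push Not at hc
  obtain ⟨A, hA⟩ : ∃ A : ℤ, A = a2 + |b1| := ⟨_, rfl⟩
  have hA' : ((8 * (a2.natAbs + b1.natAbs) : ℕ) : ℤ) = 8 * A := by
    push_cast; rw [hA, abs_of_pos ha]
  rw [hA'] at hc
  have hA1 : 1 ≤ A := by have := abs_nonneg b1; omega
  have hMy : (M:ℤ) ≤ |y| := by nlinarith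
  have hMZ : 2 * (|p3| + |p2| + |p1| + |p0|) + 1 ≤ (M:ℤ) := by zify at hM; exact hM
  have hsm := poly_small p3 p2 p1 p0 y (by omega) (by omega)
  have hy4 : |y| ^ 4 = y ^ 4 := by rw [← abs_pow]; exact abs_of_nonneg (by positivity)
  have hy1 : 1 ≤ |y| := by omega
  obtain ⟨hα0, -⟩ := quad_bdd _ _ _ D (fun x => hb x y)
  have hα : a2 * y ^ 2 + b1 * y ≤ A * y ^ 2 := by
    have : b1 * y ≤ |b1| * y ^ 2 := by
      calc b1 * y ≤ |b1 * y| := le_abs_self _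
        _ = |b1| * |y| := abs_mul _ _
        _ ≤ |b1| * |y| ^ 2 := by gcongr; exact le_self_pow₀ hy1 (by norm_num)
        _ = _ := by rw [sq_abs]
    rw [hA]; linarith
  have hid : 4 * (a2 * y ^ 2 + b1 * y) * ((a2 * y ^ 2 + b1 * y) * x ^ 2
      + (a3 * y ^ 3 + b2 * y ^ 2 + c1 * y) * x
      + (a4 * y ^ 4 + b3 * y ^ 3 + c2 * y ^ 2 + e1 * y)) =
      (2 * (a2 * y ^ 2 + b1 * y) * x + (a3 * y ^ 3 + b2 * y ^ 2 + c1 * y)) ^ 2 +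
      y ^ 2 * ((4 * a2 * a4 - a3 ^ 2) * y ^ 4 + (p3 * y ^ 3 + p2 * y ^ 2 + p1 * y + p0)) := by
    rw [hp3, hp2, hp1, hp0]; ring
  have hy2 : 0 < y ^ 2 := by rw [← sq_abs]; positivity
  have u1 : y ^ 2 * y ^ 4 ≤ 2 * (y ^ 2 *
      ((4 * a2 * a4 - a3 ^ 2) * y ^ 4 + (p3 * y ^ 3 + p2 * y ^ 2 + p1 * y + p0))) := by
    have : y ^ 4 ≤ (4 * a2 * a4 - a3 ^ 2) * y ^ 4 := by
      nlinarith [show 0 ≤ y ^ 4 by positivity]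
    have : y ^ 4 ≤ 2 *
      ((4 * a2 * a4 - a3 ^ 2) * y ^ 4 + (p3 * y ^ 3 + p2 * y ^ 2 + p1 * y + p0)) := by linarith
    calc y ^ 2 * y ^ 4 ≤ y ^ 2 * (2 *
      ((4 * a2 * a4 - a3 ^ 2) * y ^ 4 + (p3 * y ^ 3 + p2 * y ^ 2 + p1 * y + p0))) := by gcongr
      _ = _ := by ring
  have u2 : 4 * (a2 * y ^ 2 + b1 * y) * ((a2 * y ^ 2 + b1 * y) * x ^ 2
      + (a3 * y ^ 3 + b2 * y ^ 2 + c1 * y) * x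
      + (a4 * y ^ 4 + b3 * y ^ 3 + c2 * y ^ 2 + e1 * y)) ≤ 4 * (A * y ^ 2) * (M:ℤ) ^ 4 := by
    calc _ ≤ 4 * (a2 * y ^ 2 + b1 * y) * (M:ℤ) ^ 4 := by
          apply mul_le_mul_of_nonneg_left h; linarith
      _ ≤ _ := by gcongr
  have u3 : y ^ 2 * y ^ 4 ≤ y ^ 2 * (8 * A * (M:ℤ) ^ 4) := by
    have := sq_nonneg (2 * (a2 * y ^ 2 + b1 * y) * x + (a3 * y ^ 3 + b2 * y ^ 2 + c1 * y))
    rw [hid] at u2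
    have e : y ^ 2 * (8 * A * (M:ℤ) ^ 4) = 2 * (4 * (A * y ^ 2) * (M:ℤ) ^ 4) := by ring
    rw [e]
    linarith only [this, u1, u2]
  have u4 : y ^ 4 ≤ 8 * A * (M:ℤ) ^ 4 := le_of_mul_le_mul_left u3 hy2
  have u5 : (8 * A * (M:ℤ)) ^ 4 < |y| ^ 4 := by gcongr
  have u6 : 8 * A ≤ (8 * A) ^ 4 := le_self_pow₀ (by linarith) (by norm_num)
  have u7 : 8 * A * (M:ℤ) ^ 4 ≤ (8 * A) ^ 4 * (M:ℤ) ^ 4 := by gcongr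
  rw [mul_pow (8 * A)] at u5
  linarith

theorem abs_quad_le (p q r X B : ℤ) (hB : 1 ≤ B) (hX : |X| ≤ B) :
    |p * X ^ 2 + q * X + r| ≤ (|p| + |q| + |r|) * B ^ 2 := by
  have hBB : B ≤ B ^ 2 := le_self_pow₀ hB (by norm_num)
  have t2 : |p * X ^ 2| ≤ |p| * B ^ 2 := by
    rw [abs_mul, abs_pow]; gcongr
  have t1 : |q * X| ≤ |q| * B ^ 2 := by
    rw [abs_mul]; gcongr; exact hX.trans hBB
  have t0 : |r| ≤ |r| * B ^ 2 := by
    nlinarith [abs_nonneg r]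
  calc _ ≤ |p * X ^ 2| + |q * X| + |r| := by
        refine (abs_add_le _ _).trans ?_
        gcongr
        exact abs_add_le _ _
    _ ≤ _ := by linarith

theorem quad_dom (a k l m2 m1 m0 : ℤ) (ha : 0 < a) :
    ∃ K : ℕ, ∀ X : ℤ, 1 ≤ a * X ^ 2 + k * X + l →
      |m2 * X ^ 2 + m1 * X + m0| ≤ K * (a * X ^ 2 + k * X + l) := by
  obtain ⟨R, hR⟩ : ∃ R : ℤ, R = 2 * (|k| + |l|) + 2 := ⟨_, rfl⟩
  obtain ⟨m, hm⟩ : ∃ m : ℤ, m = |m2| + |m1| + |m0| := ⟨_, rfl⟩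
  have := abs_nonneg k
  have := abs_nonneg l
  have hm0 : 0 ≤ m := by rw [hm]; positivity
  have hK : 0 ≤ m * R ^ 2 := by positivity
  refine ⟨(m * R ^ 2).toNat, fun X hX => ?_⟩
  rw [Int.toNat_of_nonneg hK]
  rcases le_total |X| R with h | h
  · have := abs_quad_le m2 m1 m0 X R (by omega) h
    rw [← hm] at this
    nlinarith
  · have h1 := abs_quad_le m2 m1 m0 X |X| (by omega) le_rfl
    rw [← hm] at h1
    have h2 := abs_quad_le 0 k l X |X| (by omega) le_rfl
    have hX2 : X ^ 2 ≤ a * X ^ 2 := by nlinarith [sq_nonneg X]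
    rw [sq_abs] at h1
    have h3 : |k * X + l| ≤ (|k| + |l|) * |X| := by
      calc _ ≤ |k * X| + |l| := abs_add_le _ _
        _ ≤ |k| * |X| + |l| * |X| := by
            rw [abs_mul]
            nlinarith
        _ = _ := by ring
    have h4 : 2 * (|k| + |l|) * |X| ≤ X ^ 2 := by
      rw [← sq_abs X]; nlinarith
    have h5 := neg_abs_le (k * X + l)
    have h6 : X ^ 2 ≤ 2 * (a * X ^ 2 + k * X + l) := by linarith
    have h7 : 4 ≤ R ^ 2 := by nlinarith
    calc _ ≤ m * X ^ 2 := h1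
      _ ≤ m * (2 * (a * X ^ 2 + k * X + l)) := by gcongr
      _ ≤ m * (R ^ 2 * (a * X ^ 2 + k * X + l)) := by gcongr; linarith
      _ = _ := by ring

theorem nf_deg (a2 a3 a4 b1 b2 b3 c1 c2 e1 C D : ℤ) (hC : 0 < C) (ha : 0 < a2)
    (hδ : 4 * a2 * a4 - a3 ^ 2 = 0)
    (hF3 : b1 * a3 ^ 2 - 2 * a2 * a3 * b2 + 4 * a2 ^ 2 * b3 = 0)
    (hb : ∀ x y : ℤ, D ≤ (a2 * y ^ 2 + b1 * y) * x ^ 2 + (a3 * y ^ 3 + b2 * y ^ 2 + c1 * y) * x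
      + (a4 * y ^ 4 + b3 * y ^ 3 + c2 * y ^ 2 + e1 * y))
    (hs : ∀ n : ℤ, D ≤ C * n → ∃ x y : ℤ,
      (a2 * y ^ 2 + b1 * y) * x ^ 2 + (a3 * y ^ 3 + b2 * y ^ 2 + c1 * y) * x
      + (a4 * y ^ 4 + b3 * y ^ 3 + c2 * y ^ 2 + e1 * y) = C * n) : False := by
  obtain ⟨s, hs'⟩ : ∃ s : ℤ, s = 2 * a2 := ⟨_, rfl⟩
  obtain ⟨k1, hk1⟩ : ∃ k1 : ℤ, k1 = s * b2 - 2 * b1 * a3 := ⟨_, rfl⟩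
  obtain ⟨l1, hl1⟩ : ∃ l1 : ℤ, l1 = s ^ 2 * c2 - s * c1 * a3 := ⟨_, rfl⟩
  have hs2 : 2 ≤ s := by omega
  have hid : ∀ x y : ℤ, s ^ 2 * ((a2 * y ^ 2 + b1 * y) * x ^ 2
      + (a3 * y ^ 3 + b2 * y ^ 2 + c1 * y) * x
      + (a4 * y ^ 4 + b3 * y ^ 3 + c2 * y ^ 2 + e1 * y)) =
      y ^ 2 * (a2 * (s * x + a3 * y) ^ 2 + k1 * (s * x + a3 * y) + l1)
      + y * (b1 * (s * x + a3 * y) ^ 2 + (s * c1) * (s * x + a3 * y) + s ^ 2 * e1) := by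
    intro x y
    rw [hk1, hl1, hs']
    linear_combination a2 * y ^ 4 * hδ + y ^ 3 * hF3
  have hq : ∀ x y : ℤ, 0 ≤ a2 * (s * x + a3 * y) ^ 2 + k1 * (s * x + a3 * y) + l1 ∧
      (a2 * (s * x + a3 * y) ^ 2 + k1 * (s * x + a3 * y) + l1 = 0 →
        b1 * (s * x + a3 * y) ^ 2 + (s * c1) * (s * x + a3 * y) + s ^ 2 * e1 = 0) := by
    intro x y
    have hX : ∀ t : ℤ, s * (x - a3 * t) + a3 * (y + s * t) = s * x + a3 * y := by
      intro t; ring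
    generalize hXX : s * x + a3 * y = X at *
    obtain ⟨q, hqq⟩ : ∃ q, q = a2 * X ^ 2 + k1 * X + l1 := ⟨_, rfl⟩
    obtain ⟨m, hmm⟩ : ∃ m, m = b1 * X ^ 2 + (s * c1) * X + s ^ 2 * e1 := ⟨_, rfl⟩
    rw [← hqq, ← hmm]
    have := quad_bdd (s ^ 2 * q) (2 * y * s * q + s * m) (y ^ 2 * q + y * m) (s ^ 2 * D) (by
      intro t
      have h1 := hid (x - a3 * t) (y + s * t)
      rw [hX t, ← hqq, ← hmm] at h1
      have h2 := hb (x - a3 * t) (y + s * t)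
      have h3 := mul_le_mul_of_nonneg_left h2 (sq_nonneg s)
      rw [h1] at h3
      linarith)
    have hspos : 0 < s ^ 2 := by positivity
    refine ⟨nonneg_of_mul_nonneg_right this.1 hspos, fun h0 => ?_⟩
    have h := this.2 (by rw [h0]; ring)
    rw [h0, mul_zero, zero_add] at h
    exact (mul_eq_zero.1 h).resolve_left (by omega)
  obtain ⟨K, hK⟩ := quad_dom a2 k1 l1 b1 (s * c1) (s ^ 2 * e1) ha
  refine caseII _ _ _ C D hC hb hs (2 * s.natAbs) (2 * K + 2 * b1.natAbs + 1) ?_ ?_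
  · intro y hy
    have h1 : -(|b1| * |y|) ≤ b1 * y := by rw [← abs_mul]; exact neg_abs_le _
    have h2 : y ^ 2 ≤ a2 * y ^ 2 := by nlinarith [sq_nonneg y]
    have h3 : 2 * (|b1| * |y|) ≤ y ^ 2 := by
      rw [← sq_abs y]
      have : 2 * |b1| ≤ |y| := by push_cast at hy; omega
      nlinarith [abs_nonneg y]
    linarith
  · intro M hM x y h
    have hid := hid x y
    obtain ⟨h0, h1⟩ := hq x y
    have hK := hK (s * x + a3 * y)
    generalize s * x + a3 * y = X at *
    generalize a2 * X ^ 2 + k1 * X + l1 = q at *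
    generalize b1 * X ^ 2 + (s * c1) * X + s ^ 2 * e1 = m at *
    rcases h0.eq_or_lt with h0 | h0
    · left
      rw [h1 h0.symm, ← h0] at hid
      simp only [mul_zero, add_zero] at hid
      exact (mul_eq_zero.1 hid).resolve_left (by positivity)
    · right
      have hK := hK h0
      have hMM : (M:ℤ) ≤ (M:ℤ) ^ 2 := le_self_pow₀ (by omega) (by norm_num)
      have hs3 : ((2 * s.natAbs : ℕ) : ℤ) = 2 * s := by push_cast; rw [abs_of_pos (by omega)]
      rw [hs3]
      by_contra hc
      push Not at hc
      have hMK : 2 * (K:ℤ) ≤ M := by omega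
      have hy : 2 * (K:ℤ) ≤ |y| := by nlinarith
      have w1 : -(|y| * (K * q)) ≤ y * m := by
        have := neg_abs_le (y * m)
        rw [abs_mul] at this
        have : |y| * |m| ≤ |y| * (K * q) := by gcongr
        linarith
      have w2 : 2 * K * |y| ≤ y ^ 2 := by
        rw [← sq_abs y]; nlinarith [abs_nonneg y]
      have w3 : 2 * K * |y| * q ≤ y ^ 2 * q := by gcongr
      have w4 : y ^ 2 * 1 ≤ y ^ 2 * q := by gcongr; omega
      have w5 : s ^ 2 * ((a2 * y ^ 2 + b1 * y) * x ^ 2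
          + (a3 * y ^ 3 + b2 * y ^ 2 + c1 * y) * x
          + (a4 * y ^ 4 + b3 * y ^ 3 + c2 * y ^ 2 + e1 * y)) ≤ s ^ 2 * (M:ℤ) ^ 4 := by
        apply mul_le_mul_of_nonneg_left h (by positivity)
      have w6 : (2 * s * (M:ℤ) ^ 2) ^ 2 < |y| ^ 2 := by gcongr
      rw [sq_abs] at w6
      have w7 : 0 ≤ s ^ 2 * (M:ℤ) ^ 4 := by positivity
      nlinarith

theorem normal_form (a2 a3 a4 b1 b2 b3 c1 c2 e1 C D : ℤ) (hC : 0 < C)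
    (F : ℤ → ℤ → ℤ)
    (hF : ∀ x y, F x y = a2 * x ^ 2 * y ^ 2 + a3 * x * y ^ 3 + a4 * y ^ 4 + b1 * x ^ 2 * y
      + b2 * x * y ^ 2 + b3 * y ^ 3 + c1 * x * y + c2 * y ^ 2 + e1 * y)
    (hb : ∀ x y : ℤ, D ≤ F x y)
    (hs : ∀ n : ℤ, D ≤ C * n → ∃ x y : ℤ, F x y = C * n)
    (hA : ∀ x y : ℤ, 0 ≤ a2 * x ^ 2 * y ^ 2 + a3 * x * y ^ 3 + a4 * y ^ 4)
    (hF3 : 0 < a2 → 4 * a2 * a4 - a3 ^ 2 = 0 →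
      b1 * a3 ^ 2 - 2 * a2 * a3 * b2 + 4 * a2 ^ 2 * b3 = 0)
    (hne : ¬ (a2 = 0 ∧ a3 = 0 ∧ a4 = 0)) : False := by
  have hF' : ∀ x y, F x y = (a2 * y ^ 2 + b1 * y) * x ^ 2 + (a3 * y ^ 3 + b2 * y ^ 2 + c1 * y) * x
      + (a4 * y ^ 4 + b3 * y ^ 3 + c2 * y ^ 2 + e1 * y) := by
    intro x y; rw [hF]; ring
  simp only [hF'] at hb hs
  obtain ⟨h1, h2⟩ := quad_bdd a2 a3 a4 0 (fun x => by have := hA x 1; linarith)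
  rcases h1.eq_or_lt with h1 | h1
  · have h2 := h2 h1.symm
    subst h2
    subst h1
    have ha4 : 0 ≤ a4 := by have := hA 0 1; linarith
    have hp := quad_bdd _ _ _ D (fun x => hb x 1)
    have hm := quad_bdd _ _ _ D (fun x => hb x (-1))
    have hb1 : b1 = 0 := by have := hp.1; have := hm.1; linarith
    subst hb1
    have i1 := hp.2 (by ring)
    have i2 := hm.2 (by ring)
    have hb2 : b2 = 0 := by linarith
    have hc1 : c1 = 0 := by linarith
    subst hb2
    subst hc1
    refine nf_zero a4 b3 c2 e1 C D hC (lt_of_le_of_ne ha4 (fun h => hne ⟨rfl, rfl, h.symm⟩)) ?_ ?_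
    · intro x y
      have := hb x y
      ring_nf at this ⊢; exact this
    · intro n hn
      obtain ⟨x, y, h⟩ := hs n hn
      refine ⟨x, y, ?_⟩
      rw [← h]; ring
  · have h3 : 0 ≤ 4 * a2 * a4 - a3 ^ 2 := by
      have := hA (-a3) (2 * a2)
      have h4 : a2 * (-a3) ^ 2 * (2 * a2) ^ 2 + a3 * (-a3) * (2 * a2) ^ 3 + a4 * (2 * a2) ^ 4 =
        4 * a2 ^ 3 * (4 * a2 * a4 - a3 ^ 2) := by ring
      rw [h4] at this
      exact nonneg_of_mul_nonneg_right this (by positivity)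
    rcases h3.eq_or_lt with h3 | h3
    · exact nf_deg a2 a3 a4 b1 b2 b3 c1 c2 e1 C D hC h1 h3.symm (hF3 h1 h3.symm) hb hs
    · exact nf_pos a2 a3 a4 b1 b2 b3 c1 c2 e1 C D hC h1 h3 hb hs

/-- Integer coefficients of a quartic polynomial in two variables without constant term. -/
structure QC where
  (a0 a1 a2 a3 a4 b0 b1 b2 b3 c0 c1 c2 e0 e1 : ℤ)

namespace QC

variable {R : Type*} [CommRing R]

def f4 (Q : QC) (x y : R) : R :=
  (Q.a0 : R) * x ^ 4 + (Q.a1 : R) * x ^ 3 * y + (Q.a2 : R) * x ^ 2 * y ^ 2 + (Q.a3 : R) * x * y ^ 3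
    + (Q.a4 : R) * y ^ 4

def f3 (Q : QC) (x y : R) : R :=
  (Q.b0 : R) * x ^ 3 + (Q.b1 : R) * x ^ 2 * y + (Q.b2 : R) * x * y ^ 2 + (Q.b3 : R) * y ^ 3

def f2 (Q : QC) (x y : R) : R :=
  (Q.c0 : R) * x ^ 2 + (Q.c1 : R) * x * y + (Q.c2 : R) * y ^ 2

def f1 (Q : QC) (x y : R) : R := (Q.e0 : R) * x + (Q.e1 : R) * y

def ev (Q : QC) (x y : ℤ) : ℤ := Q.f4 x y + Q.f3 x y + Q.f2 x y + Q.f1 x y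

theorem ev_cast (Q : QC) (x y : ℤ) : ((Q.ev x y : ℤ) : ℝ) =
    Q.f4 (x:ℝ) (y:ℝ) + Q.f3 (x:ℝ) (y:ℝ) + Q.f2 (x:ℝ) (y:ℝ) + Q.f1 (x:ℝ) (y:ℝ) := by
  simp only [ev, f4, f3, f2, f1]; push_cast; rfl

theorem f4_cast (Q : QC) (x y : ℤ) : ((Q.f4 x y : ℤ) : ℝ) = Q.f4 (x:ℝ) (y:ℝ) := by
  simp only [f4]; push_cast; rfl
theorem f3_cast (Q : QC) (x y : ℤ) : ((Q.f3 x y : ℤ) : ℝ) = Q.f3 (x:ℝ) (y:ℝ) := by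
  simp only [f3]; push_cast; rfl
theorem f2_cast (Q : QC) (x y : ℤ) : ((Q.f2 x y : ℤ) : ℝ) = Q.f2 (x:ℝ) (y:ℝ) := by
  simp only [f2]; push_cast; rfl
theorem f1_cast (Q : QC) (x y : ℤ) : ((Q.f1 x y : ℤ) : ℝ) = Q.f1 (x:ℝ) (y:ℝ) := by
  simp only [f1]; push_cast; rfl

theorem f4_smul (Q : QC) (t x y : R) : Q.f4 (t * x) (t * y) = t ^ 4 * Q.f4 x y := by
  simp only [f4]; ring
theorem f3_smul (Q : QC) (t x y : R) : Q.f3 (t * x) (t * y) = t ^ 3 * Q.f3 x y := by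
  simp only [f3]; ring
theorem f2_smul (Q : QC) (t x y : R) : Q.f2 (t * x) (t * y) = t ^ 2 * Q.f2 x y := by
  simp only [f2]; ring
theorem f1_smul (Q : QC) (t x y : R) : Q.f1 (t * x) (t * y) = t * Q.f1 x y := by
  simp only [f1]; ring

theorem f4_cont (Q : QC) : Continuous (fun p : ℝ × ℝ => Q.f4 p.1 p.2) := by
  simp only [f4]; fun_prop
theorem f3_cont (Q : QC) : Continuous (fun p : ℝ × ℝ => Q.f3 p.1 p.2) := by
  simp only [f3]; fun_prop
theorem f2_cont (Q : QC) : Continuous (fun p : ℝ × ℝ => Q.f2 p.1 p.2) := by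
  simp only [f2]; fun_prop
theorem f1_cont (Q : QC) : Continuous (fun p : ℝ × ℝ => Q.f1 p.1 p.2) := by
  simp only [f1]; fun_prop

/-- rational approximations -/
noncomputable def ap (v : ℝ) (n : ℕ) : ℝ := (⌊((n:ℝ) + 1) * v⌋ : ℝ) / ((n:ℝ) + 1)

theorem ap_sub (v : ℝ) (n : ℕ) : |ap v n - v| ≤ 1 / ((n:ℝ) + 1) := by
  have hn : (0:ℝ) < (n:ℝ) + 1 := by positivity
  have : ap v n - v = (⌊((n:ℝ) + 1) * v⌋ - ((n:ℝ) + 1) * v) / ((n:ℝ) + 1) := by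
    rw [ap]; field_simp
  rw [this, abs_div, abs_of_pos hn]
  gcongr
  rw [abs_le]
  constructor
  · linarith [Int.lt_floor_add_one (((n:ℝ) + 1) * v)]
  · linarith [Int.floor_le (((n:ℝ) + 1) * v)]

theorem tendsto_inv : Filter.Tendsto (fun n : ℕ => 1 / ((n:ℝ) + 1)) Filter.atTop (nhds 0) :=
  tendsto_one_div_add_atTop_nhds_zero_nat

theorem tendsto_aps (v : ℝ) : Filter.Tendsto (fun n => ap v n - v) Filter.atTop (nhds 0) :=
  squeeze_zero_norm (fun n => by rw [Real.norm_eq_abs]; exact ap_sub v n) tendsto_inv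

theorem tendsto_ap (v : ℝ) : Filter.Tendsto (ap v) Filter.atTop (nhds v) := by
  have := (tendsto_aps v).add_const v
  simpa using this

theorem ap_ev (Q : QC) (v w : ℝ) (n : ℕ) :
    ((Q.ev ⌊((n:ℝ) + 1) * v⌋ ⌊((n:ℝ) + 1) * w⌋ : ℤ) : ℝ) =
    ((n:ℝ) + 1) ^ 4 * Q.f4 (ap v n) (ap w n) + ((n:ℝ) + 1) ^ 3 * Q.f3 (ap v n) (ap w n) +
    ((n:ℝ) + 1) ^ 2 * Q.f2 (ap v n) (ap w n) + ((n:ℝ) + 1) * Q.f1 (ap v n) (ap w n) := by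
  have hn : ((n:ℝ) + 1) ≠ 0 := by positivity
  rw [ev_cast, ← f4_smul, ← f3_smul, ← f2_smul, ← f1_smul]
  have : ∀ u, ((n:ℝ) + 1) * ap u n = ⌊((n:ℝ) + 1) * u⌋ := by
    intro u; rw [ap]; field_simp
  rw [this, this]

theorem psd (Q : QC) (D : ℤ) (hb : ∀ x y, D ≤ Q.ev x y) (v w : ℝ) : 0 ≤ Q.f4 v w := by
  have hvw : Filter.Tendsto (fun n => (ap v n, ap w n)) Filter.atTop (nhds (v, w)) :=
    (tendsto_ap v).prodMk_nhds (tendsto_ap w)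
  have t4 := (Q.f4_cont.tendsto (v, w)).comp hvw
  have t3 := (Q.f3_cont.tendsto (v, w)).comp hvw
  have t2 := (Q.f2_cont.tendsto (v, w)).comp hvw
  have t1 := (Q.f1_cont.tendsto (v, w)).comp hvw
  have i := tendsto_inv
  have key := ((t4.add (t3.mul i)).add (t2.mul (i.pow 2))).add (t1.mul (i.pow 3))
  have key2 := (i.pow 4).const_mul (D:ℝ)
  refine le_of_tendsto_of_tendsto' (b := Filter.atTop) (a₁ := 0) (a₂ := Q.f4 v w)
    (by simpa using key2) (by simpa using key) ?_
  intro n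
  have h := hb ⌊((n:ℝ) + 1) * v⌋ ⌊((n:ℝ) + 1) * w⌋
  have h' : (D:ℝ) ≤ ((Q.ev ⌊((n:ℝ) + 1) * v⌋ ⌊((n:ℝ) + 1) * w⌋ : ℤ) : ℝ) := by exact_mod_cast h
  rw [ap_ev] at h'
  have hn : (0:ℝ) < (n:ℝ) + 1 := by positivity
  have h2 := mul_le_mul_of_nonneg_right h' (show 0 ≤ (1 / ((n:ℝ) + 1)) ^ 4 by positivity)
  simp only [Function.comp, one_div, inv_pow, div_eq_mul_inv, one_mul] at h2 ⊢
  refine h2.trans (le_of_eq ?_)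
  field_simp

theorem lin_coeff_zero (c1 c2 c3 c4 : ℝ)
    (h : ∀ e : ℝ, 0 ≤ c1 * e + c2 * e ^ 2 + c3 * e ^ 3 + c4 * e ^ 4) : c1 = 0 := by
  have hd : HasDerivAt (fun e : ℝ => c1 * e + c2 * e ^ 2 + c3 * e ^ 3 + c4 * e ^ 4) c1 0 := by
    have := ((((hasDerivAt_id (0:ℝ)).const_mul c1).add ((hasDerivAt_pow 2 (0:ℝ)).const_mul c2)).add
      ((hasDerivAt_pow 3 (0:ℝ)).const_mul c3)).add ((hasDerivAt_pow 4 (0:ℝ)).const_mul c4)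
    exact HasDerivAt.congr_deriv this (by norm_num)
  refine IsLocalMin.hasDerivAt_eq_zero ?_ hd
  refine Filter.Eventually.of_forall (fun e => ?_)
  simpa using h e

theorem grad_zero (Q : QC) (hp : ∀ v w : ℝ, 0 ≤ Q.f4 v w) (v w : ℝ) (h0 : Q.f4 v w = 0) :
    4 * Q.a0 * v ^ 3 + 3 * Q.a1 * v ^ 2 * w + 2 * Q.a2 * v * w ^ 2 + Q.a3 * w ^ 3 = 0 ∧
    Q.a1 * v ^ 3 + 2 * Q.a2 * v ^ 2 * w + 3 * Q.a3 * v * w ^ 2 + 4 * Q.a4 * w ^ 3 = 0 := by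
  constructor
  · apply lin_coeff_zero _ (6 * Q.a0 * v ^ 2 + 3 * Q.a1 * v * w + Q.a2 * w ^ 2)
      (4 * Q.a0 * v + Q.a1 * w) Q.a0
    intro e
    have h := hp (v + e) w
    have : Q.f4 (v + e) w = Q.f4 v w + ((4 * Q.a0 * v ^ 3 + 3 * Q.a1 * v ^ 2 * w
      + 2 * Q.a2 * v * w ^ 2 + Q.a3 * w ^ 3) * e
      + (6 * Q.a0 * v ^ 2 + 3 * Q.a1 * v * w + Q.a2 * w ^ 2) * e ^ 2
      + (4 * Q.a0 * v + Q.a1 * w) * e ^ 3 + Q.a0 * e ^ 4) := by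
      simp only [f4]; ring
    rw [this, h0, zero_add] at h
    exact h
  · apply lin_coeff_zero _ (Q.a2 * v ^ 2 + 3 * Q.a3 * v * w + 6 * Q.a4 * w ^ 2)
      (Q.a3 * v + 4 * Q.a4 * w) Q.a4
    intro e
    have h := hp v (w + e)
    have : Q.f4 v (w + e) = Q.f4 v w + ((Q.a1 * v ^ 3 + 2 * Q.a2 * v ^ 2 * w
      + 3 * Q.a3 * v * w ^ 2 + 4 * Q.a4 * w ^ 3) * e
      + (Q.a2 * v ^ 2 + 3 * Q.a3 * v * w + 6 * Q.a4 * w ^ 2) * e ^ 2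
      + (Q.a3 * v + 4 * Q.a4 * w) * e ^ 3 + Q.a4 * e ^ 4) := by
      simp only [f4]; ring
    rw [this, h0, zero_add] at h
    exact h

theorem tendsto_hh (v w : ℝ) : Filter.Tendsto
    (fun n : ℕ => ((n:ℝ) + 1) * ((ap v n - v) * (ap w n - w))) Filter.atTop (nhds 0) := by
  refine squeeze_zero_norm (fun n => ?_) tendsto_inv
  have hn : (0:ℝ) < (n:ℝ) + 1 := by positivity
  rw [Real.norm_eq_abs, abs_mul, abs_mul, abs_of_pos hn]
  calc ((n:ℝ) + 1) * (|ap v n - v| * |ap w n - w|)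
      ≤ ((n:ℝ) + 1) * ((1 / ((n:ℝ) + 1)) * (1 / ((n:ℝ) + 1))) := by
        gcongr
        · exact ap_sub v n
        · exact ap_sub w n
    _ = 1 / ((n:ℝ) + 1) := by field_simp

theorem f3_nonneg (Q : QC) (D : ℤ) (hb : ∀ x y, D ≤ Q.ev x y) (v w : ℝ) (h0 : Q.f4 v w = 0) :
    0 ≤ Q.f3 v w := by
  obtain ⟨g0, g1⟩ := grad_zero Q (psd Q D hb) v w h0
  have hvw : Filter.Tendsto (fun n => (ap v n, ap w n)) Filter.atTop (nhds (v, w)) :=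
    (tendsto_ap v).prodMk_nhds (tendsto_ap w)
  have t3 := (Q.f3_cont.tendsto (v, w)).comp hvw
  have t2 := (Q.f2_cont.tendsto (v, w)).comp hvw
  have t1 := (Q.f1_cont.tendsto (v, w)).comp hvw
  have i := tendsto_inv
  let k1 : ℝ × ℝ → ℝ := fun h => 6 * Q.a0 * v ^ 2 + 3 * Q.a1 * v * w + Q.a2 * w ^ 2 +
    h.1 * (4 * Q.a0 * v + Q.a1 * w) + h.2 * (3 * Q.a1 * v + 2 * Q.a2 * w) +
    Q.a0 * h.1 ^ 2 + Q.a1 * h.1 * h.2 + Q.a2 * h.2 ^ 2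
  let k2 : ℝ × ℝ → ℝ := fun h => 3 * Q.a1 * v ^ 2 + 4 * Q.a2 * v * w + 3 * Q.a3 * w ^ 2 +
    h.2 * (2 * Q.a2 * v + 3 * Q.a3 * w) + Q.a3 * h.2 ^ 2
  let k3 : ℝ × ℝ → ℝ := fun h => Q.a2 * v ^ 2 + 3 * Q.a3 * v * w + 6 * Q.a4 * w ^ 2 +
    h.2 * (Q.a3 * v + 4 * Q.a4 * w) + Q.a4 * h.2 ^ 2
  have ck1 : Continuous k1 := by fun_prop
  have ck2 : Continuous k2 := by fun_prop
  have ck3 : Continuous k3 := by fun_prop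
  have hh : Filter.Tendsto (fun n => (ap v n - v, ap w n - w)) Filter.atTop (nhds (0, 0)) :=
    (tendsto_aps v).prodMk_nhds (tendsto_aps w)
  have t4 := (((tendsto_hh v v).mul ((ck1.tendsto _).comp hh)).add
    ((tendsto_hh v w).mul ((ck2.tendsto _).comp hh))).add
    ((tendsto_hh w w).mul ((ck3.tendsto _).comp hh))
  have t4' : Filter.Tendsto (fun n : ℕ => ((n:ℝ) + 1) * Q.f4 (ap v n) (ap w n)) Filter.atTop
      (nhds 0) := by
    have e : (fun n : ℕ => ((n:ℝ) + 1) * Q.f4 (ap v n) (ap w n)) = fun n : ℕ =>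
        ((n:ℝ) + 1) * ((ap v n - v) * (ap v n - v)) * (k1 ∘ fun n => (ap v n - v, ap w n - w)) n +
        ((n:ℝ) + 1) * ((ap v n - v) * (ap w n - w)) * (k2 ∘ fun n => (ap v n - v, ap w n - w)) n +
        ((n:ℝ) + 1) * ((ap w n - w) * (ap w n - w)) * (k3 ∘ fun n => (ap v n - v, ap w n - w)) n
        := by
      funext n
      simp only [Function.comp, k1, k2, k3]
      simp only [f4] at h0 ⊢
      linear_combination ((n:ℝ) + 1) * h0 + ((n:ℝ) + 1) * (ap v n - v) * g0
        + ((n:ℝ) + 1) * (ap w n - w) * g1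
    rw [e]
    simpa using t4
  have key := ((t4'.add t3).add (t2.mul i)).add (t1.mul (i.pow 2))
  have key2 := (i.pow 3).const_mul (D:ℝ)
  refine le_of_tendsto_of_tendsto' (b := Filter.atTop) (a₁ := 0) (a₂ := Q.f3 v w)
    (by simpa using key2) (by simpa using key) ?_
  intro n
  have h := hb ⌊((n:ℝ) + 1) * v⌋ ⌊((n:ℝ) + 1) * w⌋
  have h' : (D:ℝ) ≤ ((Q.ev ⌊((n:ℝ) + 1) * v⌋ ⌊((n:ℝ) + 1) * w⌋ : ℤ) : ℝ) := by exact_mod_cast h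
  rw [ap_ev] at h'
  have hn : (0:ℝ) < (n:ℝ) + 1 := by positivity
  have h2 := mul_le_mul_of_nonneg_right h' (show 0 ≤ (1 / ((n:ℝ) + 1)) ^ 3 by positivity)
  simp only [Function.comp, one_div, inv_pow, div_eq_mul_inv, one_mul] at h2 ⊢
  refine h2.trans (le_of_eq ?_)
  field_simp

theorem f3_zero (Q : QC) (D : ℤ) (hb : ∀ x y, D ≤ Q.ev x y) (v w : ℝ) (h0 : Q.f4 v w = 0) :
    Q.f3 v w = 0 := by
  have h1 := f3_nonneg Q D hb v w h0
  have h2 := f3_nonneg Q D hb (-1 * v) (-1 * w) (by rw [f4_smul, h0, mul_zero])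
  rw [f3_smul] at h2
  linarith

theorem min_bd (Q : QC) (hp : ∀ v w : ℝ, (v, w) ≠ (0, 0) → 0 < Q.f4 v w) :
    ∃ m : ℝ, 0 < m ∧ ∀ v w : ℝ, ‖(v, w)‖ = 1 → m ≤ Q.f4 v w := by
  have hcomp : IsCompact (Metric.sphere (0 : ℝ × ℝ) 1) := isCompact_sphere _ _
  obtain ⟨p0, hp0, hmin⟩ := hcomp.exists_isMinOn
    (f := fun p : ℝ × ℝ => Q.f4 p.1 p.2) ⟨(1, 0), by simp [Prod.norm_def]⟩
    Q.f4_cont.continuousOn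
  refine ⟨Q.f4 p0.1 p0.2, ?_, ?_⟩
  · apply hp
    intro h
    have h' : p0 = 0 := h
    rw [h'] at hp0
    simp at hp0
  · intro v w h
    have h2 := isMinOn_iff.1 hmin (v, w) (mem_sphere_zero_iff_norm.2 h)
    exact h2

theorem sum_bd (Q : QC) :
    ∃ S : ℝ, ∀ v w : ℝ, ‖(v, w)‖ = 1 → |Q.f3 v w| + |Q.f2 v w| + |Q.f1 v w| ≤ S := by
  have hcomp : IsCompact (Metric.sphere (0 : ℝ × ℝ) 1) := isCompact_sphere _ _
  obtain ⟨S, hS⟩ := hcomp.exists_bound_of_continuousOn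
    (f := fun p : ℝ × ℝ => |Q.f3 p.1 p.2| + |Q.f2 p.1 p.2| + |Q.f1 p.1 p.2|)
    ((Q.f3_cont.abs.add Q.f2_cont.abs).add Q.f1_cont.abs).continuousOn
  refine ⟨S, fun v w h => ?_⟩
  have h2 := hS (v, w) (mem_sphere_zero_iff_norm.2 h)
  rw [Real.norm_eq_abs] at h2
  exact (le_abs_self _).trans h2

theorem low_bd (Q : QC) (m S : ℝ)
    (hmin : ∀ v w : ℝ, ‖(v, w)‖ = 1 → m ≤ Q.f4 v w)
    (hS : ∀ v w : ℝ, ‖(v, w)‖ = 1 → |Q.f3 v w| + |Q.f2 v w| + |Q.f1 v w| ≤ S) :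
    ∀ (x y : ℝ), 1 ≤ ‖(x, y)‖ →
      m * ‖(x, y)‖ ^ 4 - S * ‖(x, y)‖ ^ 3 ≤ Q.f4 x y + Q.f3 x y + Q.f2 x y + Q.f1 x y := by
  intro x y hr
  set r := ‖(x, y)‖ with hrdef
  have hr0 : 0 < r := by linarith
  have hu : ‖(r⁻¹ * x, r⁻¹ * y)‖ = 1 := by
    have : (r⁻¹ * x, r⁻¹ * y) = r⁻¹ • (x, y) := by simp
    rw [this, norm_smul, ← hrdef, Real.norm_eq_abs,
      abs_of_pos (by positivity)]
    field_simp
  have h4 : m ≤ Q.f4 (r⁻¹ * x) (r⁻¹ * y) := hmin _ _ hu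
  have hS' := hS _ _ hu
  have ex : x = r * (r⁻¹ * x) := by field_simp
  have ey : y = r * (r⁻¹ * y) := by field_simp
  generalize r⁻¹ * x = u at *
  generalize r⁻¹ * y = z at *
  clear_value r
  subst ex ey
  rw [f4_smul, f3_smul, f2_smul, f1_smul]
  have e4 : m * r ^ 4 ≤ r ^ 4 * Q.f4 u z := by
    rw [mul_comm]; gcongr
  have e3 : -(r ^ 3 * |Q.f3 u z|) ≤ r ^ 3 * Q.f3 u z := by
    have := mul_le_mul_of_nonneg_left (neg_abs_le (Q.f3 u z)) (show 0 ≤ r ^ 3 by positivity)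
    linarith
  have e2 : -(r ^ 3 * |Q.f2 u z|) ≤ r ^ 2 * Q.f2 u z := by
    have := mul_le_mul_of_nonneg_left (neg_abs_le (Q.f2 u z)) (show 0 ≤ r ^ 2 by positivity)
    have h : r ^ 2 * |Q.f2 u z| ≤ r ^ 3 * |Q.f2 u z| := by gcongr <;> norm_num <;> exact hr
    linarith
  have e1 : -(r ^ 3 * |Q.f1 u z|) ≤ r * Q.f1 u z := by
    have := mul_le_mul_of_nonneg_left (neg_abs_le (Q.f1 u z)) (show 0 ≤ r by positivity)
    have h : r * |Q.f1 u z| ≤ r ^ 3 * |Q.f1 u z| := by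
      gcongr; exact le_self_pow₀ hr (by norm_num)
    linarith
  have e5 : (|Q.f3 u z| + |Q.f2 u z| + |Q.f1 u z|) * r ^ 3 ≤ S * r ^ 3 := by gcongr
  linarith

theorem posdef_case (Q : QC) (C D : ℤ) (hC : 0 < C)
    (hs : ∀ n : ℤ, D ≤ C * n → ∃ x y, Q.ev x y = C * n)
    (hp : ∀ v w : ℝ, (v, w) ≠ (0, 0) → 0 < Q.f4 v w) : False := by
  obtain ⟨m, hm0, hmin⟩ := min_bd Q hp
  obtain ⟨S, hS⟩ := sum_bd Q
  have hlow := low_bd Q m S hmin hS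
  obtain ⟨K, hK⟩ := exists_nat_gt (max 1 (2 / m))
  obtain ⟨M0, hM0⟩ := exists_nat_gt (2 * S / m)
  have hK1 : 1 < (K:ℝ) := (le_max_left _ _).trans_lt hK
  have hK2 : 2 / m < (K:ℝ) := (le_max_right _ _).trans_lt hK
  have hKM : ∀ M : ℕ, M0 + 1 ≤ M → ∀ x y : ℤ, Q.ev x y ≤ (M:ℤ) ^ 4 →
      ‖((x:ℝ), (y:ℝ))‖ ≤ K * M := by
    intro M hM x y h
    by_contra hc
    push Not at hc
    have hM' : (M0:ℝ) + 1 ≤ M := by exact_mod_cast hM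
    have hM1 : (1:ℝ) ≤ M := by
      have : 1 ≤ M := by omega
      exact_mod_cast this
    set r := ‖((x:ℝ), (y:ℝ))‖
    have hrM : (M:ℝ) ≤ r := by nlinarith
    have h1 := hlow x y (by linarith)
    rw [← ev_cast] at h1
    have h2 : ((Q.ev x y : ℤ) : ℝ) ≤ (M:ℝ) ^ 4 := by exact_mod_cast h
    have h3 : 2 * S ≤ r * m := by
      rw [div_lt_iff₀ hm0] at hM0
      nlinarith
    have h4 : 2 * S * r ^ 3 ≤ r * m * r ^ 3 := by gcongr
    have h5 : m * r ^ 4 ≤ 2 * (M:ℝ) ^ 4 := by nlinarith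
    have h6 : (K * (M:ℝ)) ^ 4 < r ^ 4 := by gcongr
    rw [div_lt_iff₀ hm0] at hK2
    have h7 : (K:ℝ) ≤ (K:ℝ) ^ 4 := le_self_pow₀ hK1.le (by norm_num)
    have h8 : m * (K * (M:ℝ)) ^ 4 < m * r ^ 4 := by gcongr
    have h9 : 2 * (M:ℝ) ^ 4 ≤ m * K ^ 4 * (M:ℝ) ^ 4 := by
      gcongr
      nlinarith
    rw [mul_pow] at h8
    linarith
  refine count_contra Q.ev C D hC hs ((2 * K + 1) ^ 2) (M0 + 1) ?_
  intro M hM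
  refine ⟨((Finset.Icc (-((K * M : ℕ):ℤ)) ((K * M : ℕ):ℤ)) ×ˢ
    (Finset.Icc (-((K * M : ℕ):ℤ)) ((K * M : ℕ):ℤ))).image (fun p => Q.ev p.1 p.2), ?_, ?_⟩
  · refine Finset.card_image_le.trans ?_
    rw [Finset.card_product]
    have e : (Finset.Icc (-((K * M : ℕ):ℤ)) ((K * M : ℕ):ℤ)).card = 2 * (K * M) + 1 := by
      simp only [Int.card_Icc]; omega
    rw [e]
    have hM1 : 1 ≤ M := by omega
    calc (2 * (K * M) + 1) * (2 * (K * M) + 1) ≤ (2 * (K * M) + M) * (2 * (K * M) + M) := by gcongr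
      _ = (2 * K + 1) ^ 2 * M ^ 2 := by ring
      _ ≤ (2 * K + 1) ^ 2 * M ^ 3 := by gcongr <;> omega
  · intro x y h
    have h1 := hKM M hM x y h
    rw [Prod.norm_def, max_le_iff] at h1
    simp only [Real.norm_eq_abs] at h1
    refine Finset.mem_image.2 ⟨(x, y), ?_, rfl⟩
    have h2 : |x| ≤ ((K * M : ℕ):ℤ) := by exact_mod_cast h1.1
    have h3 : |y| ≤ ((K * M : ℕ):ℤ) := by exact_mod_cast h1.2
    rw [Finset.mem_product, Finset.mem_Icc, Finset.mem_Icc]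
    exact ⟨abs_le.1 h2, abs_le.1 h3⟩

end QC

namespace QC

theorem p4_rat (Q : QC) (C D : ℤ) (hC : 0 < C) (hb : ∀ x y, D ≤ Q.ev x y)
    (hs : ∀ n : ℤ, D ≤ C * n → ∃ x y, Q.ev x y = C * n)
    (hne : ∃ v w : ℝ, Q.f4 v w ≠ 0) (p q r s : ℤ) (hdet : p * s - q * r = 1)
    (h4 : Q.f4 p q = 0) (h3 : Q.f3 p q = 0) (h2 : Q.f2 p q = 0) : False := by
  have hpsd := psd Q D hb
  have h4' : Q.f4 (p:ℝ) (q:ℝ) = 0 := by rw [← f4_cast, h4]; simp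
  obtain ⟨g0, g1⟩ := grad_zero Q hpsd _ _ h4'
  have g0' : 4 * Q.a0 * p ^ 3 + 3 * Q.a1 * p ^ 2 * q + 2 * Q.a2 * p * q ^ 2 + Q.a3 * q ^ 3 = 0 := by
    exact_mod_cast g0
  have g1' : Q.a1 * p ^ 3 + 2 * Q.a2 * p ^ 2 * q + 3 * Q.a3 * p * q ^ 2 + 4 * Q.a4 * q ^ 3 = 0 := by
    exact_mod_cast g1
  have h1 : Q.f1 p q = 0 := by
    refine (quad_bdd 0 (Q.f1 p q) 0 D (fun x => ?_)).2 rfl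
    have := hb (x * p) (x * q)
    rw [ev, f4_smul, f3_smul, f2_smul, f1_smul, h4, h3, h2] at this
    linarith
  obtain ⟨A2, hA2⟩ : ∃ A : ℤ, A = 6*Q.a0*p^2*r^2 + 3*Q.a1*(p^2*r*s + p*q*r^2)
    + Q.a2*(p^2*s^2 + 4*p*q*r*s + q^2*r^2) + 3*Q.a3*(p*q*s^2 + q^2*r*s) + 6*Q.a4*q^2*s^2 := ⟨_, rfl⟩
  obtain ⟨A3, hA3⟩ : ∃ A : ℤ, A = 4*Q.a0*p*r^3 + Q.a1*(3*p*r^2*s + q*r^3)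
    + Q.a2*(2*p*r*s^2 + 2*q*r^2*s) + Q.a3*(p*s^3 + 3*q*r*s^2) + 4*Q.a4*q*s^3 := ⟨_, rfl⟩
  obtain ⟨A4, hA4⟩ : ∃ A : ℤ, A = Q.f4 r s := ⟨_, rfl⟩
  obtain ⟨B1, hB1⟩ : ∃ A : ℤ, A = 3*Q.b0*p^2*r + Q.b1*(p^2*s + 2*p*q*r)
    + Q.b2*(2*p*q*s + q^2*r) + 3*Q.b3*q^2*s := ⟨_, rfl⟩
  obtain ⟨B2, hB2⟩ : ∃ A : ℤ, A = 3*Q.b0*p*r^2 + Q.b1*(2*p*r*s + q*r^2)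
    + Q.b2*(p*s^2 + 2*q*r*s) + 3*Q.b3*q*s^2 := ⟨_, rfl⟩
  obtain ⟨B3, hB3⟩ : ∃ A : ℤ, A = Q.f3 r s := ⟨_, rfl⟩
  obtain ⟨C1, hC1⟩ : ∃ A : ℤ, A = 2*Q.c0*p*r + Q.c1*(p*s + q*r) + 2*Q.c2*q*s := ⟨_, rfl⟩
  have T4 : ∀ x y : ℤ, Q.f4 (p*x + r*y) (q*x + s*y) = A2 * x^2 * y^2 + A3 * x * y^3 + A4 * y^4 := by
    intro x y
    simp only [hA2, hA3, hA4]
    simp only [f4, Int.cast_id] at h4 ⊢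
    linear_combination x^4 * h4 + x^3*y*r*g0' + x^3*y*s*g1'
  have T3 : ∀ x y : ℤ, Q.f3 (p*x + r*y) (q*x + s*y) = B1 * x^2 * y + B2 * x * y^2 + B3 * y^3 := by
    intro x y
    simp only [hB1, hB2, hB3]
    simp only [f3, Int.cast_id] at h3 ⊢
    linear_combination x^3 * h3
  have T2 : ∀ x y : ℤ, Q.f2 (p*x + r*y) (q*x + s*y) = C1 * x * y + Q.f2 r s * y^2 := by
    intro x y
    simp only [hC1]
    simp only [f2, Int.cast_id] at h2 ⊢
    linear_combination x^2 * h2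
  have T1 : ∀ x y : ℤ, Q.f1 (p*x + r*y) (q*x + s*y) = Q.f1 r s * y := by
    intro x y
    simp only [f1, Int.cast_id] at h1 ⊢
    linear_combination x * h1
  have T4r : ∀ x y : ℝ, Q.f4 (p*x + r*y) (q*x + s*y)
      = A2 * x^2 * y^2 + A3 * x * y^3 + A4 * y^4 := by
    intro x y
    have g0r : (4 * Q.a0 * p ^ 3 + 3 * Q.a1 * p ^ 2 * q + 2 * Q.a2 * p * q ^ 2 + Q.a3 * q ^ 3:ℝ) = 0 :=
      g0
    have g1r : (Q.a1 * p ^ 3 + 2 * Q.a2 * p ^ 2 * q + 3 * Q.a3 * p * q ^ 2 + 4 * Q.a4 * q ^ 3:ℝ) = 0 :=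
      g1
    simp only [hA2, hA3, hA4]
    simp only [f4, Int.cast_id] at h4' ⊢
    push_cast
    linear_combination x^4 * h4' + x^3*y*r*g0r + x^3*y*s*g1r
  refine normal_form A2 A3 A4 B1 B2 B3 C1 (Q.f2 r s) (Q.f1 r s) C D hC
    (fun x y => Q.ev (p*x + r*y) (q*x + s*y)) ?_ (fun x y => hb _ _) ?_ ?_ ?_ ?_
  · intro x y
    simp only [ev]
    rw [T4, T3, T2, T1]; ring
  · intro n hn
    obtain ⟨x, y, h⟩ := hs n hn
    refine ⟨s * x - r * y, -q * x + p * y, ?_⟩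
    rw [← h]
    show Q.ev _ _ = _
    congr 1
    · linear_combination x * hdet
    · linear_combination y * hdet
  · intro x y
    rw [← T4]
    have := hpsd ((p*x + r*y : ℤ):ℝ) ((q*x + s*y : ℤ) : ℝ)
    rw [← f4_cast] at this
    exact_mod_cast this
  · intro ha hd
    have z4 : Q.f4 (p*(-A3) + r*(2*A2)) (q*(-A3) + s*(2*A2)) = 0 := by
      rw [T4]
      linear_combination (4 * A2^3) * hd
    have z3 := f3_zero Q D hb ((p*(-A3) + r*(2*A2) : ℤ):ℝ) ((q*(-A3) + s*(2*A2) : ℤ) : ℝ)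
      (by rw [← f4_cast, z4]; simp)
    rw [← f3_cast] at z3
    have z3' : Q.f3 (p*(-A3) + r*(2*A2)) (q*(-A3) + s*(2*A2)) = 0 := by exact_mod_cast z3
    rw [T3] at z3'
    have : 2 * A2 * (B1 * A3 ^ 2 - 2 * A2 * A3 * B2 + 4 * A2 ^ 2 * B3) = 0 := by
      linear_combination z3'
    rcases mul_eq_zero.1 this with h | h
    · omega
    · exact h
  · rintro ⟨i2, i3, i4⟩
    obtain ⟨v, w, hvw⟩ := hne
    apply hvw
    have hdr : (p * s - q * r : ℝ) = 1 := by exact_mod_cast hdet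
    have := T4r (s * v - r * w) (-q * v + p * w)
    rw [i2, i3, i4] at this
    have e1 : (p * (s * v - r * w) + r * (-q * v + p * w) : ℝ) = v := by
      linear_combination v * hdr
    have e2 : (q * (s * v - r * w) + s * (-q * v + p * w) : ℝ) = w := by
      linear_combination w * hdr
    rw [e1, e2] at this
    rw [this]; simp

theorem quad_of (ξ : ℝ) (hξ : Irrational ξ) (a0 a1 a2 a3 a4 : ℚ)
    (hne : ¬ (a0 = 0 ∧ a1 = 0 ∧ a2 = 0 ∧ a3 = 0 ∧ a4 = 0))
    (h : a0 * ξ ^ 4 + a1 * ξ ^ 3 + a2 * ξ ^ 2 + a3 * ξ + a4 = 0)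
    (h' : 4 * a0 * ξ ^ 3 + 3 * a1 * ξ ^ 2 + 2 * a2 * ξ + a3 = 0) :
    ∃ u v : ℚ, ξ ^ 2 + u * ξ + v = 0 := by
  obtain ⟨f, hf⟩ : ∃ f : Polynomial ℚ, f = Polynomial.C a0 * Polynomial.X ^ 4 + Polynomial.C a1 * Polynomial.X ^ 3 + Polynomial.C a2 * Polynomial.X ^ 2 + Polynomial.C a3 * Polynomial.X + Polynomial.C a4 :=
    ⟨_, rfl⟩
  have hf0 : f ≠ 0 := by
    intro h0
    apply hne
    have c0 : f.coeff 4 = a0 := by rw [hf]; simp [Polynomial.coeff_X, Polynomial.coeff_C]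
    have c1 : f.coeff 3 = a1 := by rw [hf]; simp [Polynomial.coeff_X, Polynomial.coeff_C]
    have c2 : f.coeff 2 = a2 := by rw [hf]; simp [Polynomial.coeff_X, Polynomial.coeff_C]
    have c3 : f.coeff 1 = a3 := by rw [hf]; simp [Polynomial.coeff_X, Polynomial.coeff_C]
    have c4 : f.coeff 0 = a4 := by rw [hf]; simp
    rw [h0] at c0 c1 c2 c3 c4
    simp at c0 c1 c2 c3 c4
    exact ⟨c0.symm, c1.symm, c2.symm, c3.symm, c4.symm⟩
  have hfd : f.natDegree ≤ 4 := by rw [hf]; compute_degree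
  have hfx : Polynomial.aeval ξ f = 0 := by
    rw [hf]; simpa using h
  have hfx' : Polynomial.aeval ξ (Polynomial.derivative f) = 0 := by
    rw [hf]; simp; linarith
  have hIntg : IsIntegral ℚ ξ := by
    rw [← isAlgebraic_iff_isIntegral]
    exact ⟨f, hf0, hfx⟩
  have hm2 : 2 ≤ (minpoly ℚ ξ).natDegree := by
    rw [minpoly.two_le_natDegree_iff hIntg]
    rintro ⟨a, ha⟩
    exact hξ ⟨a, by simpa using ha⟩
  have hmon := minpoly.monic hIntg
  have hmx := minpoly.aeval ℚ ξ
  obtain ⟨g, hg⟩ := minpoly.dvd ℚ ξ hfx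
  have hm' : Polynomial.aeval ξ (Polynomial.derivative (minpoly ℚ ξ)) ≠ 0 := by
    intro h0
    have hd0 : Polynomial.derivative (minpoly ℚ ξ) ≠ 0 := by
      intro hh
      have := Polynomial.derivative_eq_zero.1 hh
      omega
    have h1 := Polynomial.natDegree_le_natDegree (minpoly.degree_le_of_ne_zero ℚ ξ hd0 h0)
    have h2 := Polynomial.natDegree_derivative_lt (p := minpoly ℚ ξ) (by omega)
    omega
  have hgx : Polynomial.aeval ξ g = 0 := by
    rw [hg, Polynomial.derivative_mul, map_add, map_mul, map_mul, hmx, zero_mul, add_zero] at hfx'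
    exact (mul_eq_zero.1 hfx').resolve_left hm'
  obtain ⟨k, hk⟩ := minpoly.dvd ℚ ξ hgx
  have hmne : minpoly ℚ ξ ≠ 0 := hmon.ne_zero
  have hkne : k ≠ 0 := by
    rintro rfl
    apply hf0; rw [hg, hk]; simp
  have hdeg : (minpoly ℚ ξ).natDegree = 2 := by
    rw [hg, hk, Polynomial.natDegree_mul hmne (mul_ne_zero hmne hkne),
      Polynomial.natDegree_mul hmne hkne] at hfd
    omega
  refine ⟨(minpoly ℚ ξ).coeff 1, (minpoly ℚ ξ).coeff 0, ?_⟩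
  have h2 : (minpoly ℚ ξ).coeff 2 = 1 := by rw [← hdeg]; exact hmon
  rw [Polynomial.aeval_eq_sum_range, hdeg] at hmx
  simp [Finset.sum_range_succ, h2, Algebra.smul_def] at hmx
  linarith

theorem lin_irr (ξ : ℝ) (hξ : Irrational ξ) (p q : ℚ) (h : p * ξ + q = 0) : p = 0 ∧ q = 0 := by
  by_cases hp : p = 0
  · refine ⟨hp, ?_⟩
    rw [hp] at h
    simpa using h
  · exfalso
    apply hξ
    refine ⟨-q / p, ?_⟩
    have : (p:ℝ) ≠ 0 := by exact_mod_cast hp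
    push_cast
    field_simp
    linarith

theorem unbdd_den (ξ : ℝ) (hξ : Irrational ξ) (N : ℕ) :
    ∃ ρ : ℚ, |ξ - ρ| < 1 / (ρ.den : ℝ) ^ 2 ∧ N < ρ.den := by
  by_contra hc
  push Not at hc
  apply Real.infinite_rat_abs_sub_lt_one_div_den_sq_of_irrational hξ
  obtain ⟨L, hL⟩ := exists_nat_gt ((|ξ| + 1) * N)
  refine Set.Finite.subset (((Finset.Icc (-(L:ℤ)) L) ×ˢ (Finset.range (N + 1))).image
    (fun p : ℤ × ℕ => (p.1 : ℚ) / p.2)).finite_toSet ?_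
  intro ρ hρ
  have hρ : |ξ - ρ| < 1 / (ρ.den : ℝ) ^ 2 := hρ
  have hN := hc ρ hρ
  have hd : (1:ℝ) ≤ ρ.den := by exact_mod_cast ρ.pos
  have h1 : |ξ - ρ| < 1 := by
    refine hρ.trans_le ?_
    rw [div_le_one (by positivity)]
    nlinarith
  have h2 : |(ρ:ℝ)| ≤ |ξ| + 1 := by
    have := abs_sub_abs_le_abs_sub (ρ:ℝ) ξ
    rw [abs_sub_comm] at this
    linarith
  have h3 : (ρ.num : ℝ) = ρ * ρ.den := by
    exact_mod_cast (Rat.mul_den_eq_num ρ).symm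
  have hN' : (ρ.den : ℝ) ≤ N := by exact_mod_cast hN
  have h4 : |(ρ.num : ℝ)| ≤ L := by
    rw [h3, abs_mul, abs_of_nonneg (by positivity : (0:ℝ) ≤ ρ.den)]
    refine le_trans ?_ hL.le
    gcongr
  have h5 : |ρ.num| ≤ (L:ℤ) := by exact_mod_cast h4
  refine Finset.mem_coe.2 (Finset.mem_image.2 ⟨(ρ.num, ρ.den), ?_, Rat.num_div_den ρ⟩)
  rw [Finset.mem_product, Finset.mem_Icc, Finset.mem_range]
  exact ⟨abs_le.1 h5, Nat.lt_succ_of_le hN⟩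

theorem lin_bdd (ξ : ℝ) (hξ : Irrational ξ) (α β : ℚ) (K : ℝ)
    (h : ∀ ρ : ℚ, |ξ - ρ| < 1 / (ρ.den : ℝ) ^ 2 → |(α:ℝ) * ρ.num + (β:ℝ) * ρ.den| ≤ K) :
    α = 0 ∧ β = 0 := by
  apply lin_irr ξ hξ
  by_contra hne
  have hpos : 0 < |α * ξ + β| := abs_pos.2 hne
  obtain ⟨N, hN⟩ := exists_nat_gt ((K + |(α:ℝ)|) / |α * ξ + β|)
  obtain ⟨ρ, hρ, hd⟩ := unbdd_den ξ hξ N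
  have h1 := h ρ hρ
  have hd1 : (1:ℝ) ≤ ρ.den := by exact_mod_cast ρ.pos
  have h3 : (ρ.num : ℝ) = ρ * ρ.den := by
    exact_mod_cast (Rat.mul_den_eq_num ρ).symm
  rw [div_lt_iff₀ hpos] at hN
  have hN' : (N:ℝ) < ρ.den := by exact_mod_cast hd
  have e : (α * ξ + β) * ρ.den = (α * ρ.num + β * ρ.den) + α * ((ξ - ρ) * ρ.den) := by
    rw [h3]; ring
  have h4 : |(ξ - ρ) * ρ.den| ≤ 1 := by
    rw [abs_mul, abs_of_nonneg (by positivity : (0:ℝ) ≤ ρ.den)]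
    rw [lt_div_iff₀ (by positivity)] at hρ
    have : |ξ - ρ| * ρ.den ≤ |ξ - ρ| * ρ.den ^ 2 := by
      gcongr; nlinarith
    linarith
  have h5 : |α * ξ + β| * ρ.den ≤ K + |(α:ℝ)| := by
    have e' : |α * ξ + β| * ρ.den = |(α * ξ + β) * ρ.den| := by
      rw [abs_mul, abs_of_nonneg (by positivity : (0:ℝ) ≤ ρ.den)]
    rw [e', e]
    refine (abs_add_le _ _).trans ?_
    rw [abs_mul (α:ℝ)]
    have : |(α:ℝ)| * |(ξ - ρ) * ρ.den| ≤ |(α:ℝ)| * 1 := by gcongr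
    linarith
  have h6 : (N:ℝ) * |α * ξ + β| < ρ.den * |α * ξ + β| := by gcongr
  linarith

theorem count_tail (F : ℤ → ℤ → ℤ) (a0 c0 s C D : ℤ) (hC : 0 < C)
    (hs : ∀ n : ℤ, D ≤ C * n → ∃ x y, F x y = C * n) (ha0 : 0 < a0) (hs0 : 0 < s)
    (W : ℤ → ℤ → ℤ) (hev : ∀ x y : ℤ, s ^ 2 * F x y = a0 * W x y ^ 2 + c0 * s * W x y) :
    False := by
  obtain ⟨K, hK⟩ : ∃ K : ℕ, (K : ℤ) = s ^ 2 + |c0| * s := ⟨(s ^ 2 + |c0| * s).toNat, by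
    rw [Int.toNat_of_nonneg]; positivity⟩
  refine count_contra F C D hC hs (2 * K + 1) 1 ?_
  intro M hM
  refine ⟨(Finset.Icc (-((K * M ^ 2 : ℕ):ℤ)) ((K * M ^ 2 : ℕ):ℤ)).image
    (fun w => (a0 * w ^ 2 + c0 * s * w) / s ^ 2), ?_, ?_⟩
  · refine Finset.card_image_le.trans ?_
    have e : (Finset.Icc (-((K * M ^ 2 : ℕ):ℤ)) ((K * M ^ 2 : ℕ):ℤ)).card = 2 * (K * M ^ 2) + 1 := by
      simp only [Int.card_Icc]; omega
    rw [e]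
    have h1 : M ^ 2 ≤ M ^ 3 := Nat.pow_le_pow_right hM (by norm_num)
    have h2 : 1 ≤ M ^ 3 := Nat.one_le_pow _ _ hM
    nlinarith
  · intro x y h
    refine Finset.mem_image.2 ⟨W x y, ?_, ?_⟩
    · rw [Finset.mem_Icc, ← abs_le]
      by_contra hc
      push Not at hc
      have h1 := hev x y
      generalize W x y = w at h1 hc
      generalize F x y = z at h1 h
      have hM1 : (1:ℤ) ≤ (M:ℤ) ^ 2 := by
        have : 1 ≤ M ^ 2 := Nat.one_le_pow _ _ hM
        exact_mod_cast this
      push_cast at hc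
      rw [hK] at hc
      have hcs : 0 ≤ |c0| * s := by positivity
      have h2 : s ^ 2 * (M:ℤ) ^ 2 < |w| - |c0| * s := by nlinarith
      have h3 : (M:ℤ) ^ 2 ≤ |w| := by
        have : (1:ℤ) ≤ s ^ 2 := by nlinarith
        nlinarith
      have h4 : s ^ 2 * z ≤ s ^ 2 * (M:ℤ) ^ 4 := by gcongr
      have h5 : -(|c0| * s * |w|) ≤ c0 * s * w := by
        have : |c0 * s * w| = |c0| * s * |w| := by rw [abs_mul, abs_mul, abs_of_pos hs0]
        rw [← this]; exact neg_abs_le _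
      have h6 : |w| ^ 2 ≤ a0 * w ^ 2 := by rw [sq_abs]; nlinarith [sq_nonneg w]
      have h7 : (s ^ 2 * (M:ℤ) ^ 2) * (M:ℤ) ^ 2 < (|w| - |c0| * s) * |w| := by
        apply mul_lt_mul h2 h3 (by positivity)
        have : 0 ≤ s ^ 2 * (M:ℤ) ^ 2 := by positivity
        linarith
      linarith
    · rw [← hev]
      exact Int.mul_ediv_cancel_left _ (by positivity)

theorem p4_irr (Q : QC) (C D : ℤ) (hC : 0 < C) (hb : ∀ x y, D ≤ Q.ev x y)
    (hs : ∀ n : ℤ, D ≤ C * n → ∃ x y, Q.ev x y = C * n)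
    (hne : ∃ v w : ℝ, Q.f4 v w ≠ 0) (ξ : ℝ) (hξ : Irrational ξ)
    (h4 : Q.f4 ξ 1 = 0) (h3 : Q.f3 ξ 1 = 0) (h2 : Q.f2 ξ 1 = 0) : False := by
  have hpsd := psd Q D hb
  obtain ⟨g0, -⟩ := grad_zero Q hpsd _ _ h4
  simp only [f4, f3, f2, one_pow, mul_one] at h4 h3 h2 g0
  obtain ⟨u, v, hq⟩ := quad_of ξ hξ Q.a0 Q.a1 Q.a2 Q.a3 Q.a4 (by
      rintro ⟨i0, i1, i2, i3, i4⟩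
      norm_cast at i0 i1 i2 i3 i4
      obtain ⟨x, y, hxy⟩ := hne
      apply hxy
      simp [f4, i0, i1, i2, i3, i4]) (by push_cast; linarith) (by push_cast; linarith)
  -- f2
  have hm' : 2 * ξ + u ≠ 0 := by
    intro h
    have := (lin_irr ξ hξ 2 u (by exact_mod_cast h)).1
    norm_num at this
  obtain ⟨i1, i2⟩ := lin_irr ξ hξ (Q.c1 - Q.c0 * u) (Q.c2 - Q.c0 * v) (by
    push_cast; linear_combination h2 - Q.c0 * hq)
  obtain ⟨k, hk⟩ : ∃ k : ℚ, k = Q.b1 - Q.b0 * u := ⟨_, rfl⟩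
  have hkr : (k:ℝ) = Q.b1 - Q.b0 * u := by rw [hk]; push_cast; rfl
  obtain ⟨j1, j2⟩ := lin_irr ξ hξ (Q.b2 - Q.b0 * v - k * u) (Q.b3 - k * v) (by
    push_cast; rw [hkr]; linear_combination h3 - (Q.b0 * ξ + Q.b1 - Q.b0 * u) * hq)
  obtain ⟨l, hl⟩ : ∃ k : ℚ, k = Q.a1 - Q.a0 * u := ⟨_, rfl⟩
  have hlr : (l:ℝ) = Q.a1 - Q.a0 * u := by rw [hl]; push_cast; rfl
  obtain ⟨n, hn⟩ : ∃ k : ℚ, k = Q.a2 - Q.a0 * v - l * u := ⟨_, rfl⟩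
  have hnr : (n:ℝ) = Q.a2 - Q.a0 * v - l * u := by rw [hn]; push_cast; rfl
  obtain ⟨k1, k2⟩ := lin_irr ξ hξ (Q.a3 - l * v - n * u) (Q.a4 - n * v) (by
    push_cast; linear_combination h4 - (Q.a0 * ξ ^ 2 + l * ξ + n) * hq + ξ ^ 3 * hlr + ξ ^ 2 * hnr)
  have k1r : (Q.a3 : ℝ) - l * v - n * u = 0 := by exact_mod_cast k1
  have hquo : (Q.a0 * ξ ^ 2 + l * ξ + n : ℝ) = 0 := by
    have : (2 * ξ + u) * (Q.a0 * ξ ^ 2 + l * ξ + n) = 0 := by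
      linear_combination g0 - (2 * Q.a0 * ξ + l) * hq + 3 * ξ ^ 2 * hlr + 2 * ξ * hnr - k1r
    exact (mul_eq_zero.1 this).resolve_left hm'
  obtain ⟨l1, l2⟩ := lin_irr ξ hξ (l - Q.a0 * u) (n - Q.a0 * v) (by
    push_cast; linear_combination hquo - Q.a0 * hq)
  have F4 : ∀ x y : ℝ, Q.f4 x y = Q.a0 * (x ^ 2 + u * x * y + v * y ^ 2) ^ 2 := by
    intro x y
    have e1 : (Q.a1 : ℝ) = 2 * Q.a0 * u := by
      have : (Q.a1 : ℚ) = 2 * Q.a0 * u := by linarith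
      exact_mod_cast this
    have e2 : (Q.a2 : ℝ) = 2 * Q.a0 * v + Q.a0 * u ^ 2 := by
      have : (Q.a2 : ℚ) = 2 * Q.a0 * v + Q.a0 * u ^ 2 := by
        linear_combination l2 - hn + u * l1
      exact_mod_cast this
    have e3 : (Q.a3 : ℝ) = 2 * Q.a0 * u * v := by
      have : (Q.a3 : ℚ) = 2 * Q.a0 * u * v := by
        linear_combination k1 + v * l1 + u * l2
      exact_mod_cast this
    have e4 : (Q.a4 : ℝ) = Q.a0 * v ^ 2 := by
      have : (Q.a4 : ℚ) = Q.a0 * v ^ 2 := by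
        linear_combination k2 + v * l2
      exact_mod_cast this
    rw [f4, e1, e2, e3, e4]; ring
  have F3 : ∀ x y : ℝ, Q.f3 x y = (x ^ 2 + u * x * y + v * y ^ 2) * (Q.b0 * x + k * y) := by
    intro x y
    have e2 : (Q.b2 : ℝ) = Q.b0 * v + k * u := by
      have : (Q.b2 : ℚ) = Q.b0 * v + k * u := by linarith
      exact_mod_cast this
    have e3 : (Q.b3 : ℝ) = k * v := by
      have : (Q.b3 : ℚ) = k * v := by linarith
      exact_mod_cast this
    rw [f3, e2, e3]
    linear_combination -x ^ 2 * y * hkr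
  have F2 : ∀ x y : ℝ, Q.f2 x y = Q.c0 * (x ^ 2 + u * x * y + v * y ^ 2) := by
    intro x y
    have e1 : (Q.c1 : ℝ) = Q.c0 * u := by
      have : (Q.c1 : ℚ) = Q.c0 * u := by linarith
      exact_mod_cast this
    have e2 : (Q.c2 : ℝ) = Q.c0 * v := by
      have : (Q.c2 : ℚ) = Q.c0 * v := by linarith
      exact_mod_cast this
    rw [f2, e1, e2]; ring
  have ha0 : 0 < Q.a0 := by
    have h1 : (0:ℝ) ≤ Q.a0 := by
      have := hpsd 1 0
      rw [F4] at this
      simpa using this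
    have h1' : 0 ≤ Q.a0 := by exact_mod_cast h1
    refine lt_of_le_of_ne h1' (fun h => ?_)
    obtain ⟨x, y, hxy⟩ := hne
    apply hxy
    rw [F4, ← h]; simp
  -- the integral version of the quadratic form
  obtain ⟨s, hs0, W, hW⟩ : ∃ s : ℤ, 0 < s ∧ ∃ W : ℤ → ℤ → ℤ, ∀ x y : ℤ,
      ((W x y : ℤ) : ℝ) = s * ((x:ℝ) ^ 2 + u * x * y + v * y ^ 2) := by
    refine ⟨u.den * v.den, by have := u.pos; have := v.pos; positivity,
      fun x y => u.den * v.den * x ^ 2 + u.num * v.den * x * y + v.num * u.den * y ^ 2, ?_⟩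
    intro x y
    have hu : (u.num : ℝ) = u * u.den := by exact_mod_cast (Rat.mul_den_eq_num u).symm
    have hv : (v.num : ℝ) = v * v.den := by exact_mod_cast (Rat.mul_den_eq_num v).symm
    push_cast
    rw [hu, hv]; ring
  have hs0r : (0:ℝ) < s := by exact_mod_cast hs0
  obtain ⟨B, hB⟩ : ∃ B : ℝ, B = 1 + |2 * ξ + u| := ⟨_, rfl⟩
  have hB0 : 0 ≤ B := by rw [hB]; positivity
  obtain ⟨E, hE⟩ : ∃ E : ℝ, E = 16 * (Q.a0 * B ^ 2) + 4 * (|(Q.c0:ℝ)| * B) + |(D:ℝ)| := ⟨_, rfl⟩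
  have ha0r : (0:ℝ) < Q.a0 := by exact_mod_cast ha0
  have hE0 : 0 ≤ E := by rw [hE]; positivity
  have main : ∀ ρ : ℚ, |ξ - ρ| < 1 / (ρ.den : ℝ) ^ 2 →
      |Q.f1 (ρ.num:ℝ) (ρ.den:ℝ)| ≤ 2 * E ∧ |(Q.b0:ℝ) * ρ.num + k * ρ.den| ≤ E * s := by
    intro ρ hρ
    have hd1 : (1:ℝ) ≤ ρ.den := by exact_mod_cast ρ.pos
    have hnum : (ρ.num : ℝ) = ρ * ρ.den := by
      exact_mod_cast (Rat.mul_den_eq_num ρ).symm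
    obtain ⟨Z, hZ⟩ : ∃ Z : ℝ, Z = (ρ.num:ℝ) ^ 2 + u * ρ.num * ρ.den + v * (ρ.den:ℝ) ^ 2 := ⟨_, rfl⟩
    have hZ1 : |Z| ≤ B := by
      have e : Z = (ξ - ρ) * (ρ.den:ℝ)^2 * ((ξ - ρ) - (2 * ξ + u)) := by
        rw [hZ, hnum]
        linear_combination (ρ.den:ℝ) ^ 2 * hq
      rw [lt_div_iff₀ (by positivity)] at hρ
      have h1 : |ξ - ρ| ≤ 1 := by
        have : |ξ - ρ| * 1 ≤ |ξ - ρ| * (ρ.den:ℝ) ^ 2 := by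
          gcongr; nlinarith
        linarith
      rw [e, abs_mul, abs_mul, abs_of_nonneg (by positivity : (0:ℝ) ≤ (ρ.den:ℝ) ^ 2)]
      have h2 : |(ξ - ρ) - (2 * ξ + u)| ≤ B := by
        rw [hB]
        exact (abs_sub _ _).trans (by linarith)
      calc |ξ - ρ| * (ρ.den:ℝ) ^ 2 * |(ξ - ρ) - (2 * ξ + u)| ≤ 1 * B := by gcongr
        _ = B := one_mul B
    have hZ0 : Z ≠ 0 := by
      intro h0
      have e : (ρ:ℝ) ^ 2 + u * ρ + v = 0 := by
        have : (ρ.den:ℝ) ^ 2 * ((ρ:ℝ) ^ 2 + u * ρ + v) = 0 := by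
          rw [← h0, hZ, hnum]; ring
        exact (mul_eq_zero.1 this).resolve_left (by positivity)
      have e2 : (ξ - ρ) * (ξ + (ρ + u)) = 0 := by linear_combination hq - e
      rcases mul_eq_zero.1 e2 with h | h
      · have := (lin_irr ξ hξ 1 (-ρ) (by push_cast; linarith)).1
        norm_num at this
      · have := (lin_irr ξ hξ 1 (ρ + u) (by push_cast; linarith)).1
        norm_num at this
    have hZs : 1 ≤ s * |Z| := by
      have h := hW ρ.num ρ.den
      rw [Int.cast_natCast, ← hZ] at h
      have h1 : W ρ.num ρ.den ≠ 0 := by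
        intro h0
        rw [h0] at h
        have : (s:ℝ) * Z ≠ 0 := mul_ne_zero hs0r.ne' hZ0
        exact this (by rw [← h]; simp)
      have h2 : (1:ℤ) ≤ |W ρ.num ρ.den| := Int.one_le_abs h1
      have h3 : (1:ℝ) ≤ |(W ρ.num ρ.den : ℝ)| := by exact_mod_cast h2
      rw [h, abs_mul, abs_of_pos hs0r] at h3
      exact h3
    have hall : ∀ t : ℤ, (D:ℝ) ≤ (t:ℝ) ^ 4 * (Q.a0 * Z ^ 2) +
        (t:ℝ) ^ 3 * Q.f3 (ρ.num:ℝ) (ρ.den:ℝ) + (t:ℝ) ^ 2 * (Q.c0 * Z)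
        + t * Q.f1 (ρ.num:ℝ) (ρ.den:ℝ) := by
      intro t
      have h := hb (t * ρ.num) (t * ρ.den)
      have h' : (D:ℝ) ≤ ((Q.ev (t * ρ.num) (t * ρ.den) : ℤ) : ℝ) := by exact_mod_cast h
      rw [ev_cast] at h'
      push_cast at h'
      rw [f4_smul, f3_smul, f2_smul, f1_smul, F4, F2, ← hZ] at h'
      exact h'
    have q1 := hall 1
    have q2 := hall (-1)
    have q3 := hall 2
    have q4 := hall (-2)
    norm_num at q1 q2 q3 q4
    have b4 : Q.a0 * Z ^ 2 ≤ Q.a0 * B ^ 2 := by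
      rw [← sq_abs]; gcongr
    have b2 : Q.c0 * Z ≤ |(Q.c0:ℝ)| * B := by
      refine (le_abs_self _).trans ?_
      rw [abs_mul]; gcongr
    have p4 : 0 ≤ Q.a0 * B ^ 2 := by positivity
    have p2 : 0 ≤ |(Q.c0:ℝ)| * B := by positivity
    have pD := neg_abs_le (D:ℝ)
    have f3b : |Q.f3 (ρ.num:ℝ) (ρ.den:ℝ)| ≤ E := by
      rw [hE, abs_le]; constructor <;> linarith
    have f1b : |Q.f1 (ρ.num:ℝ) (ρ.den:ℝ)| ≤ 2 * E := by
      rw [hE, abs_le]; constructor <;> linarith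
    refine ⟨f1b, ?_⟩
    rw [F3, ← hZ, abs_mul] at f3b
    have h1 : 1 * |(Q.b0:ℝ) * ρ.num + k * ρ.den| ≤ (s * |Z|) * |(Q.b0:ℝ) * ρ.num + k * ρ.den| := by
      gcongr
    have h2 : s * (|Z| * |(Q.b0:ℝ) * ρ.num + k * ρ.den|) ≤ s * E := by gcongr
    linarith
  obtain ⟨z0, z1⟩ := lin_bdd ξ hξ Q.e0 Q.e1 (2 * E) (by
    intro ρ hρ
    have := (main ρ hρ).1
    simpa [f1] using this)
  obtain ⟨y0, y1⟩ := lin_bdd ξ hξ Q.b0 k (E * s) (by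
    intro ρ hρ
    have := (main ρ hρ).2
    simpa using this)
  have hev : ∀ x y : ℤ, s ^ 2 * Q.ev x y = Q.a0 * W x y ^ 2 + Q.c0 * s * W x y := by
    intro x y
    have : ((s ^ 2 * Q.ev x y : ℤ) : ℝ) = ((Q.a0 * W x y ^ 2 + Q.c0 * s * W x y : ℤ) : ℝ) := by
      have z0' : Q.e0 = 0 := by exact_mod_cast z0
      have z1' : Q.e1 = 0 := by exact_mod_cast z1
      have y0' : (Q.b0 : ℝ) = 0 := by exact_mod_cast y0
      push_cast
      rw [ev_cast, F4, F3, F2, hW, f1, z0', z1', y0', y1]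
      push_cast
      ring
    exact_mod_cast this
  exact count_tail Q.ev Q.a0 Q.c0 s C D hC hs ha0 hs0 W hev

theorem p4 (Q : QC) (C D : ℤ) (hC : 0 < C) (hb : ∀ x y, D ≤ Q.ev x y)
    (hs : ∀ n : ℤ, D ≤ C * n → ∃ x y, Q.ev x y = C * n)
    (hne : ∃ v w : ℝ, Q.f4 v w ≠ 0) (v w : ℝ) (hvw : (v, w) ≠ (0, 0))
    (h4 : Q.f4 v w = 0) (h3 : Q.f3 v w = 0) (h2 : Q.f2 v w = 0) : False := by
  by_cases hw : w = 0
  · have hv : v ≠ 0 := by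
      rintro rfl; exact hvw (by rw [hw])
    have e1 : v⁻¹ * v = 1 := inv_mul_cancel₀ hv
    have k4 := Q.f4_smul v⁻¹ v w
    have k3 := Q.f3_smul v⁻¹ v w
    have k2 := Q.f2_smul v⁻¹ v w
    rw [h4, e1, hw] at k4
    rw [h3, e1, hw] at k3
    rw [h2, e1, hw] at k2
    simp only [f4, f3, f2] at k4 k3 k2
    simp at k4 k3 k2
    refine p4_rat Q C D hC hb hs hne 1 0 0 1 (by norm_num) ?_ ?_ ?_
    · simp [f4, k4]
    · simp [f3, k3]
    · simp [f2, k2]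
  · have e1 : w⁻¹ * w = 1 := inv_mul_cancel₀ hw
    have k4 := Q.f4_smul w⁻¹ v w
    have k3 := Q.f3_smul w⁻¹ v w
    have k2 := Q.f2_smul w⁻¹ v w
    rw [h4, e1, mul_zero] at k4
    rw [h3, e1, mul_zero] at k3
    rw [h2, e1, mul_zero] at k2
    generalize w⁻¹ * v = ξ at k4 k3 k2
    by_cases hξ : Irrational ξ
    · exact p4_irr Q C D hC hb hs hne ξ hξ k4 k3 k2
    · obtain ⟨ρ, rfl⟩ : ∃ ρ : ℚ, (ρ:ℝ) = ξ := by
        simpa [Irrational] using hξ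
      have hd : (ρ.den:ℝ) ≠ 0 := by exact_mod_cast ρ.den_ne_zero
      have en : (ρ.num : ℝ) = ρ.den * ρ := by
        rw [mul_comm]; exact_mod_cast (Rat.mul_den_eq_num ρ).symm
      have hcop : IsCoprime ρ.num (ρ.den:ℤ) := by
        rw [Int.isCoprime_iff_gcd_eq_one]
        exact ρ.reduced
      obtain ⟨a, b, hab⟩ := hcop
      have t4 : Q.f4 (ρ.num:ℝ) ((ρ.den:ℤ):ℝ) = 0 := by
        have := Q.f4_smul (ρ.den:ℝ) ρ 1
        rw [k4, mul_one, mul_zero, ← en] at this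
        exact_mod_cast this
      have t3 : Q.f3 (ρ.num:ℝ) ((ρ.den:ℤ):ℝ) = 0 := by
        have := Q.f3_smul (ρ.den:ℝ) ρ 1
        rw [k3, mul_one, mul_zero, ← en] at this
        exact_mod_cast this
      have t2 : Q.f2 (ρ.num:ℝ) ((ρ.den:ℤ):ℝ) = 0 := by
        have := Q.f2_smul (ρ.den:ℝ) ρ 1
        rw [k2, mul_one, mul_zero, ← en] at this
        exact_mod_cast this
      rw [← f4_cast] at t4
      rw [← f3_cast] at t3
      rw [← f2_cast] at t2
      exact p4_rat Q C D hC hb hs hne ρ.num ρ.den (-b) a (by linarith)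
        (by exact_mod_cast t4) (by exact_mod_cast t3) (by exact_mod_cast t2)

end QC

section glue

theorem hom_of_coeff {R : Type*} [CommRing R] {G : MvPolynomial (Fin 2) R} {n : ℕ}
    (h : ∀ d, MvPolynomial.coeff d G ≠ 0 → d.degree = n) : G.IsHomogeneous n := by
  intro d hd
  have := h d hd
  rw [Finsupp.degree_eq_weight_one] at this
  exact this

theorem degree_two (d : Fin 2 →₀ ℕ) : d.degree = d 0 + d 1 := by
  rw [Finsupp.degree_eq_sum, Fin.sum_univ_two]

/-- exponent vectors -/
noncomputable def mon (i j : ℕ) : Fin 2 →₀ ℕ := Finsupp.single 0 i + Finsupp.single 1 j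

@[simp] theorem mon_zero (i j : ℕ) : mon i j 0 = i := by simp [mon]
@[simp] theorem mon_one (i j : ℕ) : mon i j 1 = j := by simp [mon]

theorem mon_eta (d : Fin 2 →₀ ℕ) : mon (d 0) (d 1) = d := by
  ext i
  fin_cases i <;> simp

theorem aeval_hom {R S : Type*} [CommRing R] [CommRing S] [Algebra R S]
    {G : MvPolynomial (Fin 2) R} {n : ℕ} (hG : G.IsHomogeneous n) (x y : S) :
    MvPolynomial.aeval ![x, y] G = ∑ i ∈ Finset.range (n + 1),
      algebraMap R S (MvPolynomial.coeff (mon i (n - i)) G) * (x ^ i * y ^ (n - i)) := by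
  rw [MvPolynomial.aeval_def, MvPolynomial.eval₂_eq']
  simp only [Fin.prod_univ_two, Matrix.cons_val_zero, Matrix.cons_val_one]
  have hsub : G.support ⊆ (Finset.range (n + 1)).image (fun i => mon i (n - i)) := by
    intro d hd
    have h1 : d.degree = n := by
      by_contra h
      exact (MvPolynomial.mem_support_iff.1 hd) (hG.coeff_eq_zero h)
    rw [degree_two] at h1
    refine Finset.mem_image.2 ⟨d 0, Finset.mem_range.2 (by omega), ?_⟩
    rw [← h1, Nat.add_sub_cancel_left, mon_eta]
  rw [Finset.sum_subset hsub (fun d _ hd => by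
    rw [MvPolynomial.notMem_support_iff.1 hd]; simp)]
  rw [Finset.sum_image]
  · simp
  · intro i _ j _ h
    have := congrArg (fun d : Fin 2 →₀ ℕ => d 0) h
    simpa using this

theorem coeff_hc (F : MvPolynomial (Fin 2) ℤ) (n i : ℕ) (hi : i ≤ n) :
    MvPolynomial.coeff (mon i (n - i)) (MvPolynomial.homogeneousComponent n F)
      = MvPolynomial.coeff (mon i (n - i)) F := by
  rw [MvPolynomial.coeff_homogeneousComponent, degree_two]
  simp
  omega

/-- The coefficients of a polynomial. -/
noncomputable def toQC (F : MvPolynomial (Fin 2) ℤ) : QC where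
  a0 := MvPolynomial.coeff (mon 4 0) F
  a1 := MvPolynomial.coeff (mon 3 1) F
  a2 := MvPolynomial.coeff (mon 2 2) F
  a3 := MvPolynomial.coeff (mon 1 3) F
  a4 := MvPolynomial.coeff (mon 0 4) F
  b0 := MvPolynomial.coeff (mon 3 0) F
  b1 := MvPolynomial.coeff (mon 2 1) F
  b2 := MvPolynomial.coeff (mon 1 2) F
  b3 := MvPolynomial.coeff (mon 0 3) F
  c0 := MvPolynomial.coeff (mon 2 0) F
  c1 := MvPolynomial.coeff (mon 1 1) F
  c2 := MvPolynomial.coeff (mon 0 2) F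
  e0 := MvPolynomial.coeff (mon 1 0) F
  e1 := MvPolynomial.coeff (mon 0 1) F

variable {S : Type*} [CommRing S]

theorem toQC_f4 (F : MvPolynomial (Fin 2) ℤ) (x y : S) :
    MvPolynomial.aeval ![x, y] (MvPolynomial.homogeneousComponent 4 F) = (toQC F).f4 x y := by
  rw [aeval_hom (MvPolynomial.homogeneousComponent_isHomogeneous 4 F)]
  simp only [Finset.sum_range_succ, Finset.sum_range_zero]
  rw [coeff_hc _ _ _ (by norm_num), coeff_hc _ _ _ (by norm_num), coeff_hc _ _ _ (by norm_num),
    coeff_hc _ _ _ (by norm_num), coeff_hc _ _ _ (by norm_num)]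
  simp [QC.f4, toQC]
  ring

theorem toQC_f3 (F : MvPolynomial (Fin 2) ℤ) (x y : S) :
    MvPolynomial.aeval ![x, y] (MvPolynomial.homogeneousComponent 3 F) = (toQC F).f3 x y := by
  rw [aeval_hom (MvPolynomial.homogeneousComponent_isHomogeneous 3 F)]
  simp only [Finset.sum_range_succ, Finset.sum_range_zero]
  rw [coeff_hc _ _ _ (by norm_num), coeff_hc _ _ _ (by norm_num), coeff_hc _ _ _ (by norm_num),
    coeff_hc _ _ _ (by norm_num)]
  simp [QC.f3, toQC]
  ring

theorem toQC_f2 (F : MvPolynomial (Fin 2) ℤ) (x y : S) :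
    MvPolynomial.aeval ![x, y] (MvPolynomial.homogeneousComponent 2 F) = (toQC F).f2 x y := by
  rw [aeval_hom (MvPolynomial.homogeneousComponent_isHomogeneous 2 F)]
  simp only [Finset.sum_range_succ, Finset.sum_range_zero]
  rw [coeff_hc _ _ _ (by norm_num), coeff_hc _ _ _ (by norm_num), coeff_hc _ _ _ (by norm_num)]
  simp [QC.f2, toQC]
  ring

theorem toQC_f1 (F : MvPolynomial (Fin 2) ℤ) (x y : S) :
    MvPolynomial.aeval ![x, y] (MvPolynomial.homogeneousComponent 1 F) = (toQC F).f1 x y := by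
  rw [aeval_hom (MvPolynomial.homogeneousComponent_isHomogeneous 1 F)]
  simp only [Finset.sum_range_succ, Finset.sum_range_zero]
  rw [coeff_hc _ _ _ (by norm_num), coeff_hc _ _ _ (by norm_num)]
  simp [QC.f1, toQC]
  ring

theorem toQC_ev (F : MvPolynomial (Fin 2) ℤ) (hdeg : F.totalDegree = 4)
    (h0 : MvPolynomial.eval ![0, 0] F = 0) (x y : ℤ) :
    MvPolynomial.eval ![x, y] F = (toQC F).ev x y := by
  have hz : MvPolynomial.coeff 0 F = 0 := by
    have : (![0, 0] : Fin 2 → ℤ) = 0 := by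
      ext i; fin_cases i <;> rfl
    rw [this] at h0
    rw [← MvPolynomial.constantCoeff_eq, ← MvPolynomial.eval_zero]
    exact h0
  have hsum := MvPolynomial.sum_homogeneousComponent F
  rw [hdeg] at hsum
  conv_lhs => rw [← hsum]
  simp only [Finset.sum_range_succ, Finset.sum_range_zero, map_add]
  rw [← MvPolynomial.coe_aeval_eq_eval]
  simp only [RingHom.coe_coe]
  rw [toQC_f4, toQC_f3, toQC_f2, toQC_f1, MvPolynomial.homogeneousComponent_zero, hz, QC.ev]
  simp
  ring

theorem top_ne_zero {R : Type*} [CommRing R] (p : MvPolynomial (Fin 2) R) (hp : p ≠ 0) :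
    MvPolynomial.homogeneousComponent p.totalDegree p ≠ 0 := by
  obtain ⟨d, hd, h⟩ := Finset.exists_mem_eq_sup p.support (MvPolynomial.support_nonempty.2 hp)
    (fun s => s.sum fun _ e => e)
  intro h0
  apply MvPolynomial.mem_support_iff.1 hd
  have h1 := MvPolynomial.coeff_homogeneousComponent p.totalDegree p d
  rw [h0, if_pos] at h1
  · simpa using h1.symm
  · exact h.symm

theorem top_mul {R : Type*} [CommRing R] (p q : MvPolynomial (Fin 2) R) :
    MvPolynomial.homogeneousComponent (p.totalDegree + q.totalDegree) (p * q) =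
    MvPolynomial.homogeneousComponent p.totalDegree p *
      MvPolynomial.homogeneousComponent q.totalDegree q := by
  ext d
  have hh := (MvPolynomial.homogeneousComponent_isHomogeneous p.totalDegree p).mul
    (MvPolynomial.homogeneousComponent_isHomogeneous q.totalDegree q)
  rw [MvPolynomial.coeff_homogeneousComponent]
  split_ifs with hd
  · rw [MvPolynomial.coeff_mul, MvPolynomial.coeff_mul]
    refine Finset.sum_congr rfl ?_
    rintro ⟨a, b⟩ hab
    rw [Finset.HasAntidiagonal.mem_antidiagonal] at hab
    simp only at hab ⊢
    have hab' : a.degree + b.degree = p.totalDegree + q.totalDegree := by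
      rw [← hd, ← hab, map_add]
    rw [MvPolynomial.coeff_homogeneousComponent, MvPolynomial.coeff_homogeneousComponent]
    rcases lt_trichotomy a.degree p.totalDegree with h | h | h
    · have : MvPolynomial.coeff b q = 0 := by
        apply MvPolynomial.coeff_eq_zero_of_totalDegree_lt
        show q.totalDegree < b.degree
        omega
      rw [this]; simp
    · rw [if_pos h, if_pos (by omega)]
    · have : MvPolynomial.coeff a p = 0 := by
        apply MvPolynomial.coeff_eq_zero_of_totalDegree_lt
        exact h
      rw [this]; simp
  · rw [hh.coeff_eq_zero hd]

theorem top_dvd {R : Type*} [CommRing R] [IsDomain R] (d P : MvPolynomial (Fin 2) R) (n : ℕ)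
    (hP : P.IsHomogeneous n) (h : d ∣ P) :
    MvPolynomial.homogeneousComponent d.totalDegree d ∣ P := by
  by_cases hP0 : P = 0
  · rw [hP0]; exact dvd_zero _
  obtain ⟨e, rfl⟩ := h
  have hd0 : d ≠ 0 := left_ne_zero_of_mul hP0
  have he0 : e ≠ 0 := right_ne_zero_of_mul hP0
  have h1 := hP.totalDegree hP0
  rw [MvPolynomial.totalDegree_mul_of_isDomain hd0 he0] at h1
  have h2 := top_mul d e
  rw [h1, MvPolynomial.homogeneousComponent_eq_self hP] at h2
  exact ⟨_, h2⟩

theorem cofactor_hom {R : Type*} [CommRing R] [IsDomain R] (d e : MvPolynomial (Fin 2) R) (r n : ℕ)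
    (hd : d.IsHomogeneous r) (hP : (d * e).IsHomogeneous n) (hP0 : d * e ≠ 0) :
    ∃ m, e.IsHomogeneous m := by
  have hd0 : d ≠ 0 := left_ne_zero_of_mul hP0
  have he0 : e ≠ 0 := right_ne_zero_of_mul hP0
  have h1 := hP.totalDegree hP0
  rw [MvPolynomial.totalDegree_mul_of_isDomain hd0 he0] at h1
  have h2 := top_mul d e
  rw [h1, MvPolynomial.homogeneousComponent_eq_self hP, hd.totalDegree hd0,
    MvPolynomial.homogeneousComponent_eq_self hd] at h2
  have h3 := mul_left_cancel₀ hd0 h2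
  refine ⟨e.totalDegree, ?_⟩
  rw [h3]
  have h4 := MvPolynomial.homogeneousComponent_isHomogeneous e.totalDegree e
  rw [← h3] at h4 ⊢
  exact h4

end glue

section glue2

theorem aeval_toQ (G : MvPolynomial (Fin 2) ℤ) (x y : ℝ) :
    MvPolynomial.aeval ![x, y] (toQ G) = evalReal G x y := by
  rw [toQ, evalReal]
  exact MvPolynomial.aeval_map_algebraMap ℚ ![x, y] G

theorem toQ_inj : Function.Injective toQ :=
  MvPolynomial.map_injective _ (RingHom.injective_int _)

theorem toQ_hom {G : MvPolynomial (Fin 2) ℤ} {n : ℕ} (h : G.IsHomogeneous n) :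
    (toQ G).IsHomogeneous n := by
  apply hom_of_coeff
  intro d hd
  by_contra hc
  apply hd
  rw [toQ, MvPolynomial.coeff_map, h.coeff_eq_zero hc]
  simp

theorem toQ_mul (A B : MvPolynomial (Fin 2) ℤ) : toQ (A * B) = toQ A * toQ B := by
  simp [toQ]

theorem toQ_C (a : ℤ) : toQ (MvPolynomial.C a) = MvPolynomial.C (a : ℚ) := by
  simp [toQ]

theorem evalReal_mul (A B : MvPolynomial (Fin 2) ℤ) (x y : ℝ) :
    evalReal (A * B) x y = evalReal A x y * evalReal B x y := by
  simp [evalReal]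

theorem prim_part (P : MvPolynomial (Fin 2) ℤ) (hP : P ≠ 0) :
    ∃ (g : ℤ) (G : MvPolynomial (Fin 2) ℤ), 0 < g ∧ P = MvPolynomial.C g * G ∧
      IsPrimitiveInt G := by
  obtain ⟨g, hg⟩ : ∃ g : ℤ, g = P.support.gcd (fun m => MvPolynomial.coeff m P) := ⟨_, rfl⟩
  have hgd : ∀ m, g ∣ MvPolynomial.coeff m P := by
    intro m
    by_cases hm : m ∈ P.support
    · rw [hg]; exact Finset.gcd_dvd hm
    · rw [MvPolynomial.notMem_support_iff.1 hm]; exact dvd_zero _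
  have hg0 : g ≠ 0 := by
    intro h0
    apply hP
    ext m
    have := hgd m
    rw [h0, zero_dvd_iff] at this
    simpa using this
  obtain ⟨G, hG⟩ := (MvPolynomial.C_dvd_iff_dvd_coeff |g| P).2 (fun m => (abs_dvd g _).2 (hgd m))
  refine ⟨|g|, G, abs_pos.2 hg0, hG, ?_⟩
  intro d hd
  have h1 : |g| * d ∣ g := by
    conv_rhs => rw [hg]
    apply Finset.dvd_gcd
    intro m _
    rw [hG, MvPolynomial.coeff_C_mul]
    exact mul_dvd_mul_left _ (hd m)
  have h2 : |g| * d ∣ |g| * 1 := by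
    rw [mul_one]; exact (dvd_abs _ _).2 h1
  have h3 := (mul_dvd_mul_iff_left (abs_ne_zero.2 hg0)).1 h2
  exact isUnit_of_dvd_one h3

theorem hom_of_C_mul {g : ℤ} (hg : g ≠ 0) {G : MvPolynomial (Fin 2) ℤ} {n : ℕ}
    (h : (MvPolynomial.C g * G).IsHomogeneous n) : G.IsHomogeneous n := by
  apply hom_of_coeff
  intro d hd
  by_contra hc
  have := h.coeff_eq_zero hc
  rw [MvPolynomial.coeff_C_mul] at this
  exact (mul_ne_zero hg hd) this

theorem exists_tilde (F4 : MvPolynomial (Fin 2) ℤ) (hF : F4 ≠ 0) (h4 : F4.IsHomogeneous 4) :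
    ∃ Ft4, IsTildePart F4 Ft4 := by
  classical
  let P : ℕ → Prop := fun k => ∃ P0 Ft4 : MvPolynomial (Fin 2) ℤ, P0.IsHomogeneous k ∧ PosDef2 P0 ∧
    F4 = P0 * Ft4 ∧ (∃ n, Ft4.IsHomogeneous n) ∧ IsPrimitiveInt Ft4
  have hbd : ∀ k, P k → k ≤ 4 := by
    rintro k ⟨P0, Ft4, h1, h2, h3, h5, h6⟩
    rw [h3] at hF
    have e := h4.totalDegree (h3 ▸ hF)
    rw [h3, MvPolynomial.totalDegree_mul_of_isDomain (left_ne_zero_of_mul hF)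
      (right_ne_zero_of_mul hF), h1.totalDegree (left_ne_zero_of_mul hF)] at e
    omega
  have hP0 : P 0 := by
    obtain ⟨g, G, hg, hG, hp⟩ := prim_part F4 hF
    refine ⟨MvPolynomial.C g, G, MvPolynomial.isHomogeneous_C _ _, ?_, hG, ⟨4, ?_⟩, hp⟩
    · intro x y _
      simp [evalReal, hg]
    · exact hom_of_C_mul hg.ne' (hG ▸ h4)
  obtain ⟨P0, Ft4, h1, h2, h3, h5, h6⟩ := Nat.findGreatest_spec (P := P) (Nat.zero_le 4) hP0
  refine ⟨Ft4, P0, _, h1, h2, h3, h5, h6, ?_⟩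
  intro P0' Ft4' k' i1 i2 i3 i5 i6
  have hk : P k' := ⟨P0', Ft4', i1, i2, i3, i5, i6⟩
  exact Nat.le_findGreatest (hbd k' hk) hk

theorem gauss_dvd (d : MvPolynomial (Fin 2) ℤ) (hd : IsPrimitiveInt d) (M : ℤ) :
    M ≠ 0 → ∀ Q : MvPolynomial (Fin 2) ℤ, d ∣ MvPolynomial.C M * Q → d ∣ Q := by
  induction M using UniqueFactorizationMonoid.induction_on_prime with
  | h₁ => intro h; exact absurd rfl h
  | h₂ x hx =>
    intro _ Q h
    have : IsUnit (MvPolynomial.C x : MvPolynomial (Fin 2) ℤ) := hx.map MvPolynomial.C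
    exact (this.dvd_mul_left).1 h
  | h₃ a p ha hp ih =>
    intro _ Q h
    apply ih ha
    obtain ⟨e, he⟩ := h
    have hpC : Prime (MvPolynomial.C p : MvPolynomial (Fin 2) ℤ) := (MvPolynomial.prime_C_iff _).2 hp
    rw [map_mul, mul_assoc] at he
    have h1 : MvPolynomial.C p ∣ d * e := ⟨_, he.symm⟩
    rcases hpC.dvd_or_dvd h1 with h2 | h2
    · exfalso
      exact hp.not_isUnit (hd p ((MvPolynomial.C_dvd_iff_dvd_coeff p d).1 h2))
    · obtain ⟨e', rfl⟩ := h2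
      refine ⟨e', ?_⟩
      apply mul_left_cancel₀ hpC.ne_zero
      rw [he]; ring

theorem clear_den (d : MvPolynomial (Fin 2) ℚ) :
    ∃ (N : ℤ) (d0 : MvPolynomial (Fin 2) ℤ), 0 < N ∧ toQ d0 = MvPolynomial.C (N : ℚ) * d := by
  induction d using MvPolynomial.induction_on with
  | C a =>
    refine ⟨a.den, MvPolynomial.C a.num, by exact_mod_cast a.pos, ?_⟩
    rw [toQ_C, ← map_mul]
    congr 1
    rw [mul_comm]
    exact_mod_cast (Rat.mul_den_eq_num a).symm
  | add p q hp hq =>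
    obtain ⟨N1, d1, h1, e1⟩ := hp
    obtain ⟨N2, d2, h2, e2⟩ := hq
    refine ⟨N1 * N2, MvPolynomial.C N2 * d1 + MvPolynomial.C N1 * d2, by positivity, ?_⟩
    have : toQ (MvPolynomial.C N2 * d1 + MvPolynomial.C N1 * d2)
      = toQ (MvPolynomial.C N2 * d1) + toQ (MvPolynomial.C N1 * d2) := by simp [toQ]
    rw [this, toQ_mul, toQ_mul, e1, e2, toQ_C, toQ_C, Int.cast_mul, map_mul]
    ring
  | mul_X p n hp =>
    obtain ⟨N1, d1, h1, e1⟩ := hp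
    refine ⟨N1, d1 * MvPolynomial.X n, h1, ?_⟩
    have : toQ (MvPolynomial.X n) = MvPolynomial.X n := by simp [toQ]
    rw [toQ_mul, e1, this]; ring

theorem evalReal_cont {G : MvPolynomial (Fin 2) ℤ} {n : ℕ} (h : G.IsHomogeneous n) :
    Continuous (fun p : ℝ × ℝ => evalReal G p.1 p.2) := by
  simp only [evalReal, aeval_hom h]
  fun_prop

theorem sign_def {G : MvPolynomial (Fin 2) ℤ} {n : ℕ} (h : G.IsHomogeneous n)
    (hz : ∀ x y : ℝ, (x, y) ≠ (0, 0) → evalReal G x y ≠ 0) : PosDef2 G ∨ PosDef2 (-G) := by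
  by_contra hc
  rw [not_or] at hc
  obtain ⟨c1, c2⟩ := hc
  unfold PosDef2 at c1 c2
  push Not at c1 c2
  obtain ⟨x1, y1, n1, h1⟩ := c1
  obtain ⟨x2, y2, n2, h2⟩ := c2
  have h2' : 0 ≤ evalReal G x2 y2 := by
    have : evalReal (-G) x2 y2 = - evalReal G x2 y2 := by simp [evalReal]
    rw [this] at h2; linarith
  have hr : 1 < Module.rank ℝ (ℝ × ℝ) := by
    rw [rank_prod']
    simp only [Module.rank_self]
    exact Cardinal.one_lt_two.trans_eq one_add_one_eq_two.symm
  have hcon := (isConnected_compl_singleton_of_one_lt_rank hr (0 : ℝ × ℝ)).isPreconnected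
  obtain ⟨p, hp, hp0⟩ := hcon.intermediate_value (a := (x1, y1)) (b := (x2, y2)) n1 n2
    (evalReal_cont h).continuousOn ⟨h1, h2'⟩
  exact hz p.1 p.2 hp hp0

theorem natDegree_dehom {P : MvPolynomial (Fin 2) ℚ} {n : ℕ} (hP : P.IsHomogeneous n) :
    (MvPolynomial.aeval ![(Polynomial.X : Polynomial ℚ), 1] P).natDegree ≤ n := by
  rw [aeval_hom hP]
  apply Polynomial.natDegree_sum_le_of_forall_le
  intro i hi
  rw [Finset.mem_range] at hi
  simp only [one_pow, mul_one, Polynomial.algebraMap_eq]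
  exact (Polynomial.natDegree_C_mul_X_pow_le _ _).trans (by omega)

theorem dehom_root {P : MvPolynomial (Fin 2) ℚ} {n : ℕ} (hP : P.IsHomogeneous n) (v w : ℝ)
    (hw : w ≠ 0) (h : MvPolynomial.aeval ![v, w] P = 0) :
    Polynomial.aeval (v / w) (MvPolynomial.aeval ![(Polynomial.X : Polynomial ℚ), 1] P) = 0 := by
  rw [aeval_hom hP] at h ⊢
  have e : ∑ i ∈ Finset.range (n + 1), algebraMap ℚ ℝ (MvPolynomial.coeff (mon i (n - i)) P) *
      (v ^ i * w ^ (n - i)) = w ^ n * Polynomial.aeval (v / w) (∑ i ∈ Finset.range (n + 1),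
      algebraMap ℚ (Polynomial ℚ) (MvPolynomial.coeff (mon i (n - i)) P) *
      (Polynomial.X ^ i * 1 ^ (n - i))) := by
    rw [map_sum, Finset.mul_sum]
    refine Finset.sum_congr rfl ?_
    intro i hi
    rw [Finset.mem_range] at hi
    simp only [one_pow, mul_one, Polynomial.algebraMap_eq, map_mul, Polynomial.aeval_C, map_pow,
      Polynomial.aeval_X]
    have : w ^ n = w ^ (n - i) * w ^ i := by rw [← pow_add]; congr 1; omega
    rw [this, div_pow]
    field_simp
  rw [e] at h
  exact (mul_eq_zero.1 h).resolve_left (pow_ne_zero _ hw)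

theorem X_one_dvd {P : MvPolynomial (Fin 2) ℚ} {n : ℕ} (hP : P.IsHomogeneous n) (v : ℝ)
    (hv : v ≠ 0) (h : MvPolynomial.aeval ![v, 0] P = 0) : MvPolynomial.X 1 ∣ P := by
  rw [aeval_hom hP, Finset.sum_range_succ, Finset.sum_eq_zero] at h
  · simp at h
    have hc : MvPolynomial.coeff (mon n 0) P = 0 := h.resolve_right (fun hh => hv hh.1)
    rw [P.as_sum]
    apply Finset.dvd_sum
    intro d hd
    rw [MvPolynomial.X_dvd_monomial]
    right
    intro h1
    apply MvPolynomial.mem_support_iff.1 hd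
    by_cases hdn : d.degree = n
    · rw [degree_two, h1, add_zero] at hdn
      rw [← mon_eta d, hdn, h1, hc]
    · exact hP.coeff_eq_zero hdn
  · intro i hi
    rw [Finset.mem_range] at hi
    rw [zero_pow (by omega)]; simp

theorem commonFactor2_of_zero (A B : MvPolynomial (Fin 2) ℤ) (m n : ℕ) (hA : A.IsHomogeneous m)
    (hB : B.IsHomogeneous n) (hA0 : A ≠ 0) (v w : ℝ) (hvw : (v, w) ≠ (0, 0))
    (zA : evalReal A v w = 0) (zB : evalReal B v w = 0) : CommonFactor2 A B := by
  have hA' := toQ_hom hA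
  have hB' := toQ_hom hB
  rw [← aeval_toQ] at zA zB
  have hA0' : toQ A ≠ 0 := by
    intro h
    apply hA0
    apply toQ_inj
    rw [h]; simp [toQ]
  by_cases hw : w = 0
  · subst hw
    have hv : v ≠ 0 := by rintro rfl; exact hvw rfl
    exact ⟨MvPolynomial.X 1, by simp, X_one_dvd hA' v hv zA, X_one_dvd hB' v hv zB⟩
  · have rA := dehom_root hA' v w hw zA
    have rB := dehom_root hB' v w hw zB
    have eA := Polynomial.homogenize_eq_of_isHomogeneous hA' rfl
    have eB := Polynomial.homogenize_eq_of_isHomogeneous hB' rfl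
    have dA := natDegree_dehom hA'
    have dB := natDegree_dehom hB'
    generalize MvPolynomial.aeval ![(Polynomial.X : Polynomial ℚ), 1] (toQ A) = p at *
    generalize MvPolynomial.aeval ![(Polynomial.X : Polynomial ℚ), 1] (toQ B) = q at *
    generalize v / w = ξ at *
    have hp0 : p ≠ 0 := by
      rintro rfl
      apply hA0'
      rw [← eA]; simp
    have hIntg : IsIntegral ℚ ξ := isAlgebraic_iff_isIntegral.1 ⟨p, hp0, rA⟩
    have hm0 := minpoly.ne_zero hIntg
    have hmp := minpoly.natDegree_pos hIntg
    have key : ∀ (p : Polynomial ℚ) (k : ℕ), p.natDegree ≤ k → Polynomial.aeval ξ p = 0 →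
        (minpoly ℚ ξ).homogenize (minpoly ℚ ξ).natDegree ∣ p.homogenize k := by
      intro p k hk hz
      by_cases hp : p = 0
      · rw [hp]; simp
      obtain ⟨g, rfl⟩ := minpoly.dvd ℚ ξ hz
      have hg0 : g ≠ 0 := right_ne_zero_of_mul hp
      rw [Polynomial.natDegree_mul hm0 hg0] at hk
      have : k = (minpoly ℚ ξ).natDegree + (k - (minpoly ℚ ξ).natDegree) := by omega
      rw [this, Polynomial.homogenize_mul _ _ le_rfl (by omega)]
      exact dvd_mul_right _ _
    refine ⟨(minpoly ℚ ξ).homogenize (minpoly ℚ ξ).natDegree, ?_, ?_, ?_⟩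
    · rw [(Polynomial.isHomogeneous_homogenize _).totalDegree]
      · exact hmp
      · rw [Ne, Polynomial.homogenize_eq_zero_iff le_rfl]
        exact hm0
    · rw [← eA]; exact key p m dA rA
    · rw [← eB]; exact key q n dB rB

/-- a definite common factor contradicts maximality of the positive definite part -/
theorem no_definite_factor (F4 Ft4 : MvPolynomial (Fin 2) ℤ) (hF4 : F4 ≠ 0)
    (hT : IsTildePart F4 Ft4) (d : MvPolynomial (Fin 2) ℚ) (r : ℕ) (hr : 0 < r)
    (hd : d.IsHomogeneous r) (hd0 : d ≠ 0) (hdvd : d ∣ toQ Ft4)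
    (hz : ∀ x y : ℝ, (x, y) ≠ (0, 0) → MvPolynomial.aeval ![x, y] d ≠ 0) : False := by
  obtain ⟨P0, k, h1, h2, h3, ⟨n, h5⟩, h6, hmax⟩ := hT
  obtain ⟨N, d0, hN, ed0⟩ := clear_den d
  have hNq : (N:ℚ) ≠ 0 := by exact_mod_cast hN.ne'
  have hd00 : d0 ≠ 0 := by
    rintro rfl
    have : toQ 0 = 0 := by simp [toQ]
    rw [this] at ed0
    have h := mul_eq_zero.1 ed0.symm
    rcases h with h | h
    · rw [MvPolynomial.C_eq_zero] at h; exact hNq h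
    · exact hd0 h
  have hd0h : d0.IsHomogeneous r := by
    apply hom_of_coeff
    intro m hm
    by_contra hc
    apply hm
    have e := congrArg (MvPolynomial.coeff m) ed0
    rw [MvPolynomial.coeff_C_mul, hd.coeff_eq_zero hc, mul_zero, toQ, MvPolynomial.coeff_map] at e
    simpa using e
  obtain ⟨g, d1, hg, ed1, hprim⟩ := prim_part d0 hd00
  have hd1h : d1.IsHomogeneous r := hom_of_C_mul hg.ne' (ed1 ▸ hd0h)
  obtain ⟨e, he⟩ := hdvd
  obtain ⟨N2, e0, hN2, ee0⟩ := clear_den e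
  have hdiv : d1 ∣ Ft4 := by
    apply gauss_dvd d1 hprim (N * N2) (by positivity)
    refine ⟨MvPolynomial.C g * e0, ?_⟩
    apply toQ_inj
    have : d1 * (MvPolynomial.C g * e0) = d0 * e0 := by rw [ed1]; ring
    rw [this, toQ_mul, toQ_mul, ed0, ee0, toQ_C, he, Int.cast_mul, map_mul]
    ring
  have hz1 : ∀ x y : ℝ, (x, y) ≠ (0, 0) → evalReal d1 x y ≠ 0 := by
    intro x y hxy h0
    apply hz x y hxy
    have h7 : evalReal d0 x y = 0 := by rw [ed1, evalReal_mul, h0, mul_zero]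
    rw [← aeval_toQ, ed0, map_mul] at h7
    refine (mul_eq_zero.1 h7).resolve_left ?_
    simp [hN.ne']
  have hFt0 : Ft4 ≠ 0 := by
    rintro rfl; apply hF4; rw [h3, mul_zero]
  -- choose the sign
  have fin : ∀ d2 : MvPolynomial (Fin 2) ℤ, d2.IsHomogeneous r → PosDef2 d2 → d2 ∣ Ft4 → False := by
    rintro d2 hh hpd ⟨e2, he2⟩
    have hk := hmax (P0 * d2) e2 (k + r) (h1.mul hh) ?_ ?_ ?_ ?_
    · omega
    · intro x y hxy
      rw [evalReal_mul]
      exact mul_pos (h2 x y hxy) (hpd x y hxy)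
    · rw [h3, he2, mul_assoc]
    · exact cofactor_hom d2 e2 r n hh (he2 ▸ h5) (he2 ▸ hFt0)
    · intro c hc
      apply h6
      rw [← MvPolynomial.C_dvd_iff_dvd_coeff] at hc ⊢
      rw [he2]
      exact hc.mul_left d2
  rcases sign_def hd1h hz1 with h | h
  · exact fin d1 hd1h h hdiv
  · exact fin (-d1) hd1h.neg h (neg_dvd.2 hdiv)

end glue2

theorem not_linked_value_set_ne
    (F : MvPolynomial (Fin 2) ℤ) (hdeg : F.totalDegree = 4)
    (h0 : MvPolynomial.eval ![0, 0] F = 0) (hnl : ¬ Linked F)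
    (C : ℤ) (hC : 0 < C) (D : ℤ) :
    valueSet F ≠ targetSet C D := by
  intro heq
  have hb : ∀ x y, D ≤ (toQC F).ev x y := by
    intro x y
    have h : (toQC F).ev x y ∈ valueSet F := ⟨x, y, toQC_ev F hdeg h0 x y⟩
    rw [heq] at h
    exact h.2
  have hs : ∀ n : ℤ, D ≤ C * n → ∃ x y, (toQC F).ev x y = C * n := by
    intro n hn
    have h : C * n ∈ targetSet C D := ⟨⟨n, rfl⟩, hn⟩
    rw [← heq] at h
    obtain ⟨x, y, hxy⟩ := h
    exact ⟨x, y, by rw [← toQC_ev F hdeg h0]; exact hxy⟩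
  have hF0 : F ≠ 0 := by
    rintro rfl
    simp at hdeg
  have hF4 : MvPolynomial.homogeneousComponent 4 F ≠ 0 := by
    rw [← hdeg]; exact top_ne_zero F hF0
  have hh4 := MvPolynomial.homogeneousComponent_isHomogeneous 4 F
  have hh3 := MvPolynomial.homogeneousComponent_isHomogeneous 3 F
  have hh2 := MvPolynomial.homogeneousComponent_isHomogeneous 2 F
  have E4 : ∀ x y : ℝ, evalReal (MvPolynomial.homogeneousComponent 4 F) x y = (toQC F).f4 x y :=
    fun x y => toQC_f4 F x y
  have E3 : ∀ x y : ℝ, evalReal (MvPolynomial.homogeneousComponent 3 F) x y = (toQC F).f3 x y :=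
    fun x y => toQC_f3 F x y
  have E2 : ∀ x y : ℝ, evalReal (MvPolynomial.homogeneousComponent 2 F) x y = (toQC F).f2 x y :=
    fun x y => toQC_f2 F x y
  have hpsd : ∀ x y : ℝ, 0 ≤ (toQC F).f4 x y := QC.psd _ D hb
  have hne : ∃ v w : ℝ, (toQC F).f4 v w ≠ 0 := by
    by_contra hc
    push Not at hc
    apply hF4
    apply MvPolynomial.funext
    intro x
    have hx : x = ![x 0, x 1] := by ext i; fin_cases i <;> rfl
    have h1 : MvPolynomial.eval ![x 0, x 1] (MvPolynomial.homogeneousComponent 4 F)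
        = (toQC F).f4 (x 0) (x 1) := by
      rw [← MvPolynomial.coe_aeval_eq_eval]
      exact toQC_f4 F (x 0) (x 1)
    have h2 := hc (x 0) (x 1)
    rw [← QC.f4_cast] at h2
    have h3 : (toQC F).f4 (x 0) (x 1) = 0 := by exact_mod_cast h2
    rw [hx, h1, h3]; simp
  by_cases hpd : ∀ v w : ℝ, (v, w) ≠ (0, 0) → 0 < (toQC F).f4 v w
  · exact QC.posdef_case _ C D hC hs hpd
  push Not at hpd
  obtain ⟨v, w, hvw, hle⟩ := hpd
  have z4 : (toQC F).f4 v w = 0 := le_antisymm hle (hpsd v w)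
  have z3 : (toQC F).f3 v w = 0 := QC.f3_zero _ D hb v w z4
  obtain ⟨Ft4, hT⟩ := exists_tilde _ hF4 hh4
  obtain ⟨P0, k, p1, p2, p3, ⟨n, p5⟩, p6, -⟩ := id hT
  have hFt0 : Ft4 ≠ 0 := by
    rintro rfl; apply hF4; rw [p3, mul_zero]
  have hcf2 : CommonFactor2 Ft4 (MvPolynomial.homogeneousComponent 3 F) := by
    refine commonFactor2_of_zero _ _ n 3 p5 hh3 hFt0 v w hvw ?_ ?_
    · have h := E4 v w
      rw [z4, p3, evalReal_mul] at h
      exact (mul_eq_zero.1 h).resolve_left (p2 v w hvw).ne'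
    · rw [E3, z3]
  have hcf3 : CommonFactor3 Ft4 (MvPolynomial.homogeneousComponent 3 F)
      (MvPolynomial.homogeneousComponent 2 F) := by
    by_contra hc
    apply hnl
    refine ⟨?_, Ft4, hT, hcf2, hc⟩
    intro x y
    rw [E4]; exact hpsd x y
  obtain ⟨d, hd, d4, d3, d2⟩ := hcf3
  have hd0 : d ≠ 0 := by
    rintro rfl; simp at hd
  have t4 := top_dvd d _ n (toQ_hom p5) d4
  have t3 := top_dvd d _ 3 (toQ_hom hh3) d3
  have t2 := top_dvd d _ 2 (toQ_hom hh2) d2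
  have hdt0 := top_ne_zero d hd0
  have hdth := MvPolynomial.homogeneousComponent_isHomogeneous d.totalDegree d
  by_cases hz : ∀ x y : ℝ, (x, y) ≠ (0, 0) →
      MvPolynomial.aeval ![x, y] (MvPolynomial.homogeneousComponent d.totalDegree d) ≠ 0
  · exact no_definite_factor _ Ft4 hF4 hT _ d.totalDegree hd hdth hdt0 t4 hz
  push Not at hz
  obtain ⟨x, y, hxy, hz⟩ := hz
  have kill : ∀ G : MvPolynomial (Fin 2) ℤ,
      MvPolynomial.homogeneousComponent d.totalDegree d ∣ toQ G → evalReal G x y = 0 := by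
    rintro G ⟨e, he⟩
    rw [← aeval_toQ, he, map_mul, hz, zero_mul]
  refine QC.p4 (toQC F) C D hC hb hs hne x y hxy ?_ ?_ ?_
  · rw [← E4, p3, evalReal_mul, kill _ t4, mul_zero]
  · rw [← E3, kill _ t3]
  · rw [← E2, kill _ t2]
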